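/- Let (Γ, x_0) be a perfect rooted tree of height h ≥ 1 and let t satisfy ⌈(h+1)/2⌉ ≤ t ≤ h+1. Then reg(R/I_t(Γ)) = Σ_{x : h−t ≤ ℓ(x) ≤ h−2} deg⁺(x), summing over vertices of Γ at levels between h−t and h−2. -/

import Mathlib

open MvPolynomial

structure MinFreeRes (k σ : Type) [Field k] (I : Ideal (MvPolynomial σ k)) where
  b : ℕ → ℕ
  deg : (i : ℕ) → Fin (b i) → ℕ
  d : (i : ℕ) → ((Fin (b (i + 1)) → MvPolynomial σ k) →ₗ[MvPolynomial σ k]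
        (Fin (b i) → MvPolynomial σ k))
  aug : (Fin (b 0) → MvPolynomial σ k) →ₗ[MvPolynomial σ k] (MvPolynomial σ k ⧸ I)
  aug_surjective : Function.Surjective aug
  exact_zero : Function.Exact (d 0) aug
  exact_succ : ∀ i : ℕ, Function.Exact (d (i + 1)) (d i)
  aug_homog : ∀ j : Fin (b 0), ∃ p : MvPolynomial σ k,
      p.IsHomogeneous (deg 0 j) ∧ aug (Pi.single j 1) = Ideal.Quotient.mk I p
  d_homog : ∀ (i : ℕ) (j : Fin (b (i + 1))) (l : Fin (b i)),
      (d i (Pi.single j 1) l).IsHomogeneous (deg (i + 1) j - deg i l) ∧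
        (deg (i + 1) j < deg i l → d i (Pi.single j 1) l = 0)
  minimal : ∀ (i : ℕ) (j : Fin (b (i + 1))) (l : Fin (b i)),
      MvPolynomial.constantCoeff (d i (Pi.single j 1) l) = 0

/-- The Castelnuovo-Mumford regularity of the module `R/I`, defined as the supremum of
`j - i` over the nonzero graded Betti numbers `β_{i,j}(R/I)`, read off from (any)
minimal graded free resolution of `R/I`. -/
noncomputable def reg (k σ : Type) [Field k] (I : Ideal (MvPolynomial σ k)) : ℤ :=
  sSup {x : ℤ | ∃ F : MinFreeRes k σ I, ∃ i : ℕ, ∃ j : Fin (F.b i), x = (F.deg i j : ℤ) - i}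

/-- A rooted tree on the vertex set `V`, encoded by the parent function (every edge is
directed away from the root). -/
structure RTree (V : Type) where
  root : V
  parent : V → V
  parent_root : parent root = root
  reach : ∀ v : V, ∃ n : ℕ, parent^[n] v = root

namespace RTree

variable {V : Type} [Fintype V] [DecidableEq V]

/-- The level of a vertex: its distance from the root. -/
noncomputable def level (T : RTree V) (v : V) : ℕ := Nat.find (T.reach v)

/-- The height of the rooted tree: the maximal level of a vertex. -/
noncomputable def height (T : RTree V) : ℕ := Finset.univ.sup fun v => T.level v

/-- The outdegree of a vertex: its number of children. -/
noncomputable def outdeg (T : RTree V) (x : V) : ℕ :=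
  Nat.card {y : V // T.parent y = x ∧ y ≠ T.root}

/-- A leaf is a vertex with no children. -/
def IsLeaf (T : RTree V) (x : V) : Prop := ∀ y : V, T.parent y = x → y = T.root

/-- A rooted tree is perfect if every leaf has level equal to the height. -/
def Perfect (T : RTree V) : Prop := ∀ x : V, T.IsLeaf x → T.level x = T.height

/-- The monomial of the directed path on `t` vertices ending at `v`
(valid when `level v ≥ t - 1`). -/
noncomputable def pathMonomial (T : RTree V) (k : Type) [Field k] (t : ℕ) (v : V) :
    MvPolynomial V k := ∏ j ∈ Finset.range t, MvPolynomial.X (T.parent^[j] v)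

/-- The `t`-path ideal `I_t(Γ)`: generated by the monomials of directed paths on
`t` vertices. -/
noncomputable def pathIdeal (T : RTree V) (k : Type) [Field k] (t : ℕ) :
    Ideal (MvPolynomial V k) :=
  Ideal.span {m | ∃ v : V, t ≤ T.level v + 1 ∧ m = T.pathMonomial k t v}

end RTree



section KoszulOps

variable {V : Type} [Fintype V] [DecidableEq V]

/-- sign of inserting `v` into `S` -/
noncomputable def sg (v : V) (S : Finset V) : ℤ :=
  (-1) ^ (S.filter (fun u => Fintype.equivFin V u < Fintype.equivFin V v)).card

lemma sg_mul_self (v : V) (S : Finset V) : sg v S * sg v S = 1 := by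
  unfold sg
  rw [← pow_add, ← two_mul, pow_mul]; simp

lemma sg_empty (v : V) : sg v ∅ = 1 := by simp [sg]

lemma sg_insert_self (v : V) (S : Finset V) : sg v (insert v S) = sg v S := by
  unfold sg
  rw [Finset.filter_insert]; simp

lemma sg_erase_self (v : V) (S : Finset V) : sg v (S.erase v) = sg v S := by
  by_cases h : v ∈ S
  · conv_rhs => rw [← Finset.insert_erase h]
    rw [sg_insert_self]
  · rw [Finset.erase_eq_of_notMem h]

lemma sg_insert (u v : V) (S : Finset V) (h : u ∉ S) :
    sg v (insert u S) =
      (if Fintype.equivFin V u < Fintype.equivFin V v then -1 else 1) * sg v S := by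
  unfold sg
  rw [Finset.filter_insert]
  split_ifs with h1
  · rw [Finset.card_insert_of_notMem (by simp [h]), pow_succ]; ring
  · simp

lemma sg_erase (u v : V) (S : Finset V) (h : u ∈ S) :
    sg v (S.erase u) =
      (if Fintype.equivFin V u < Fintype.equivFin V v then -1 else 1) * sg v S := by
  have := sg_insert u v (S.erase u) (by simp)
  rw [Finset.insert_erase h] at this
  rw [this]
  split_ifs <;> ring

lemma cmp_sign (u v : V) (h : u ≠ v) :
    (if Fintype.equivFin V u < Fintype.equivFin V v then (-1 : ℤ) else 1) =
    - (if Fintype.equivFin V v < Fintype.equivFin V u then (-1 : ℤ) else 1) := by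
  have h' : Fintype.equivFin V u ≠ Fintype.equivFin V v := by simpa using h
  rcases lt_or_gt_of_ne h' with h1 | h1
  · simp [h1, not_lt_of_gt h1]
  · simp [h1, not_lt_of_gt h1]

variable (R : Type) [CommRing R] {M M' : Type} [AddCommGroup M] [Module R M]
  [AddCommGroup M'] [Module R M']

/-- contraction by `v` -/
noncomputable def pd (v : V) : (Finset V → M) →ₗ[R] (Finset V → M) where
  toFun z S := if v ∈ S then 0 else sg v S • z (insert v S)
  map_add' z w := by
    funext S; simp only [Pi.add_apply]; split_ifs <;> simp
  map_smul' r z := by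
    funext S; simp only [Pi.smul_apply, RingHom.id_apply]; split_ifs
    · simp
    · rw [smul_comm]

/-- exterior multiplication by `v` -/
noncomputable def ep (v : V) : (Finset V → M) →ₗ[R] (Finset V → M) where
  toFun z S := if v ∈ S then sg v S • z (S.erase v) else 0
  map_add' z w := by
    funext S; simp only [Pi.add_apply]; split_ifs <;> simp
  map_smul' r z := by
    funext S; simp only [Pi.smul_apply, RingHom.id_apply]; split_ifs
    · rw [smul_comm]
    · simp

lemma pd_apply (v : V) (z : Finset V → M) (S : Finset V) :
    pd R v z S = if v ∈ S then 0 else sg v S • z (insert v S) := rfl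

lemma ep_apply (v : V) (z : Finset V → M) (S : Finset V) :
    ep R v z S = if v ∈ S then sg v S • z (S.erase v) else 0 := rfl

lemma pd_pd_self (v : V) (z : Finset V → M) : pd R v (pd R v z) = 0 := by
  funext S; simp [pd_apply]

lemma pd_anticomm (u v : V) (z : Finset V → M) : pd R u (pd R v z) = - pd R v (pd R u z) := by
  by_cases huv : u = v
  · subst huv; simp [pd_pd_self]
  funext S
  simp only [pd_apply, Pi.neg_apply, Finset.mem_insert]
  by_cases hu : u ∈ S
  · simp [hu]
  by_cases hv : v ∈ S
  · simp [hv]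
  have hvu : v ≠ u := fun h => huv h.symm
  simp only [hu, hv, huv, hvu, if_false, or_false]
  rw [sg_insert u v S hu, sg_insert v u S hv, Finset.insert_comm, cmp_sign u v huv, smul_smul,
    smul_smul, ← neg_smul]
  congr 1; ring

lemma pd_ep (u v : V) (z : Finset V → M) :
    pd R u (ep R v z) + ep R v (pd R u z) = if u = v then z else 0 := by
  funext S
  simp only [pd_apply, ep_apply, Pi.add_apply, Finset.mem_insert]
  by_cases huv : u = v
  · subst huv
    by_cases hu : u ∈ S
    · simp [hu, sg_erase_self, smul_smul, sg_mul_self]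
    · simp [hu, sg_insert_self, smul_smul, sg_mul_self]
  · have hvu : v ≠ u := fun h => huv h.symm
    by_cases hu : u ∈ S
    · simp [hu, huv]
    by_cases hv : v ∈ S
    · simp only [hu, hv, huv, hvu, if_false, if_true, or_true, Finset.mem_erase, and_false,
        Pi.zero_apply]
      rw [sg_insert u v S hu, sg_erase v u S hv, Finset.erase_insert_of_ne huv, smul_smul, smul_smul,
        ← add_smul, cmp_sign u v huv]
      rw [show ∀ a b c : ℤ, a * (-b * c) + c * (b * a) = 0 by intros; ring, zero_smul]
    · simp [hu, hv, hvu, huv]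

lemma pd_map (f : M →ₗ[R] M') (v : V) (z : Finset V → M) :
    pd R v (fun S => f (z S)) = fun S => f (pd R v z S) := by
  funext S; simp only [pd_apply]; split_ifs
  · simp
  · rw [map_zsmul]

end KoszulOps

section Koszul

variable {V : Type} [Fintype V] [DecidableEq V] {k : Type} [Field k]
  {M M' : Type} [AddCommGroup M] [Module (MvPolynomial V k) M]
  [AddCommGroup M'] [Module (MvPolynomial V k) M']

variable (k) in
/-- Koszul differential restricted to the variables in `A` -/
noncomputable def dKA (A : Finset V) :
    (Finset V → M) →ₗ[MvPolynomial V k] (Finset V → M) :=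
  ∑ v ∈ A, (X v : MvPolynomial V k) • pd (MvPolynomial V k) v

variable (k) in
/-- Koszul differential -/
noncomputable def dK : (Finset V → M) →ₗ[MvPolynomial V k] (Finset V → M) :=
  dKA k Finset.univ

lemma dKA_pd (A : Finset V) (v : V) (z : Finset V → M) :
    dKA k A (pd (MvPolynomial V k) v z) = - pd (MvPolynomial V k) v (dKA k A z) := by
  simp only [dKA, LinearMap.sum_apply, LinearMap.smul_apply, map_sum, map_smul]
  rw [← Finset.sum_neg_distrib]
  refine Finset.sum_congr rfl fun u _ => ?_
  rw [pd_anticomm, smul_neg]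

lemma dKA_dKA (A : Finset V) (z : Finset V → M) : dKA k A (dKA k A z) = 0 := by
  induction A using Finset.induction_on with
  | empty => simp [dKA]
  | insert v A hv ih =>
    have : ∀ z : Finset V → M, dKA k (insert v A) z =
        (X v : MvPolynomial V k) • pd (MvPolynomial V k) v z + dKA k A z := by
      intro z; simp [dKA, Finset.sum_insert hv]
    rw [this, this, map_add, map_add, ih, map_smul, map_smul, dKA_pd, pd_pd_self]
    simp

lemma dK_dK (z : Finset V → M) : dK k (dK k z) = 0 := dKA_dKA _ z

lemma dK_apply (z : Finset V → M) (S : Finset V) :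
    dK k z S = ∑ v, (X v : MvPolynomial V k) • pd (MvPolynomial V k) v z S := by
  simp [dK, dKA, Finset.sum_apply]

lemma dK_map (f : M →ₗ[MvPolynomial V k] M') (z : Finset V → M) :
    dK k (fun S => f (z S)) = fun S => f (dK k z S) := by
  funext S
  simp only [dK_apply, pd_map, map_sum, map_smul]

lemma dK_ep (v : V) (z : Finset V → M) :
    dK k (ep (MvPolynomial V k) v z) =
      (X v : MvPolynomial V k) • z - ep (MvPolynomial V k) v (dK k z) := by
  have : dK k (ep (MvPolynomial V k) v z) + ep (MvPolynomial V k) v (dK k z) =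
      (X v : MvPolynomial V k) • z := by
    simp only [dK, dKA, LinearMap.sum_apply, LinearMap.smul_apply, map_sum, map_smul,
      ← Finset.sum_add_distrib, ← smul_add, pd_ep]
    simp
  rw [← this]; simp

lemma dK_mem (N : Submodule (MvPolynomial V k) M) (z : Finset V → M) (h : ∀ S, z S ∈ N)
    (S : Finset V) : dK k z S ∈ N := by
  rw [dK_apply]
  refine Submodule.sum_mem _ fun v _ => Submodule.smul_mem _ _ ?_
  rw [pd_apply]; split_ifs
  · exact N.zero_mem
  · exact zsmul_mem (h _) _

lemma ep_mem (N : Submodule (MvPolynomial V k) M) (v : V) (z : Finset V → M) (h : ∀ S, z S ∈ N)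
    (S : Finset V) : ep (MvPolynomial V k) v z S ∈ N := by
  rw [ep_apply]; split_ifs
  · exact zsmul_mem (h _) _
  · exact N.zero_mem

end Koszul


section GradedB

variable {V : Type} {k : Type} [Field k]

lemma hc_mul {m : ℕ} {g : MvPolynomial V k} (hg : g.IsHomogeneous m) (n : ℕ)
    (f : MvPolynomial V k) :
    homogeneousComponent n (g * f) =
      if m ≤ n then g * homogeneousComponent (n - m) f else 0 := by
  conv_lhs => rw [← sum_homogeneousComponent f, Finset.mul_sum, map_sum]
  have : ∀ i, homogeneousComponent n (g * homogeneousComponent i f) =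
      if m + i = n then g * homogeneousComponent i f else 0 := by
    intro i
    have h := hg.mul (homogeneousComponent_isHomogeneous i f)
    rw [homogeneousComponent_of_mem h]
    simp only [eq_comm]
  simp only [this]
  split_ifs with h
  · rw [Finset.sum_eq_single (n - m)]
    · rw [if_pos (by omega)]
    · intro i _ hi; rw [if_neg (by omega)]
    · intro hi
      rw [if_pos (by omega), homogeneousComponent_eq_zero, mul_zero]
      rw [Finset.mem_range] at hi; omega
  · refine Finset.sum_eq_zero fun i _ => if_neg (by omega)

/-- the component of degree `e` of an element of `R(-d)` -/
noncomputable def hcs (d e : ℕ) : MvPolynomial V k →ₗ[k] MvPolynomial V k :=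
  if d ≤ e then homogeneousComponent (e - d) else 0

lemma hcs_mul {a d e : ℕ} {g : MvPolynomial V k} (hg : g.IsHomogeneous (a - d))
    (hg0 : a < d → g = 0) (f : MvPolynomial V k) :
    hcs d e (g * f) = g * hcs a e f := by
  unfold hcs
  by_cases had : a < d
  · simp [hg0 had]
  by_cases h1 : d ≤ e
  · rw [if_pos h1, hc_mul hg]
    by_cases h2 : a ≤ e
    · rw [if_pos h2, if_pos (by omega)]
      congr 3; omega
    · rw [if_neg h2, if_neg (by omega)]; simp
  · rw [if_neg h1, if_neg (by omega)]; simp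

lemma hcs_X_mul (d e : ℕ) (v : V) (f : MvPolynomial V k) :
    hcs d (e + 1) (X v * f) = X v * hcs d e f := by
  unfold hcs
  by_cases h : d ≤ e
  · rw [if_pos h, if_pos (by omega), hc_mul (isHomogeneous_X k v), if_pos (by omega)]
    congr 3; omega
  · rw [if_neg h]
    split_ifs with h2
    · rw [hc_mul (isHomogeneous_X k v), if_neg (by omega)]; simp
    · simp

lemma hcs_self {d e : ℕ} {f : MvPolynomial V k} (hf : f.IsHomogeneous (e - d))
    (hf0 : e < d → f = 0) : hcs d e f = f := by
  unfold hcs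
  split_ifs with h
  · exact homogeneousComponent_eq_self hf
  · rw [hf0 (by omega)]; simp

lemma hcs_hom (d e : ℕ) (f : MvPolynomial V k) :
    (hcs d e f).IsHomogeneous (e - d) := by
  unfold hcs
  split_ifs with h
  · exact homogeneousComponent_isHomogeneous _ _
  · simpa using isHomogeneous_zero _ _ _

lemma hcs_zero_of_lt {d e : ℕ} (h : e < d) (f : MvPolynomial V k) : hcs d e f = 0 := by
  unfold hcs; rw [if_neg (by omega)]; simp

lemma hcs_hcs (d e : ℕ) (f : MvPolynomial V k) : hcs d e (hcs d e f) = hcs d e f :=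
  hcs_self (hcs_hom d e f) fun h => hcs_zero_of_lt h f

/-- closed under homogeneous components -/
def HomI (I : Ideal (MvPolynomial V k)) : Prop :=
  ∀ f ∈ I, ∀ n, homogeneousComponent n f ∈ I

end GradedB

section PPsec

variable {V : Type} [Fintype V] [DecidableEq V] {k : Type} [Field k]

/-- vanishing of the Koszul homology of `R/I` in coefficient degrees `> N` -/
def PP (I : Ideal (MvPolynomial V k)) (N : ℕ) : Prop :=
  ∀ p, N < p → ∀ z : Finset V → MvPolynomial V k, (∀ S, (z S).IsHomogeneous p) →
    (∀ S, dK k z S ∈ I) → ∃ w : Finset V → MvPolynomial V k, ∀ S, z S - dK k w S ∈ I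

lemma dK_hcs (d n : ℕ) (z : Finset V → MvPolynomial V k) (S : Finset V) :
    hcs d (n + 1) (dK k z S) = dK k (fun S => hcs d n (z S)) S := by
  simp only [dK_apply, map_sum, smul_eq_mul, hcs_X_mul, pd_apply]
  refine Finset.sum_congr rfl fun v _ => ?_
  split_ifs
  · simp
  · rw [map_zsmul]

lemma hcs_zero_left (n : ℕ) : (hcs 0 n : MvPolynomial V k →ₗ[k] MvPolynomial V k) =
    homogeneousComponent n := by simp [hcs]

lemma PP_colon {I I' : Ideal (MvPolynomial V k)} (hI : HomI I) (v : V) (N : ℕ)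
    (hcol : ∀ f, X v * f ∈ I ↔ f ∈ I')
    (h1 : PP (I ⊔ Ideal.span {X v}) (N + 1)) (h2 : PP I' N) : PP I (N + 1) := by
  intro p hp z hz hdz
  obtain ⟨q, rfl⟩ : ∃ q, p = q + 1 := ⟨p - 1, by omega⟩
  obtain ⟨w, hw⟩ := h1 (q + 1) hp z hz (fun S => Ideal.mem_sup_left (hdz S))
  have hab : ∀ S, ∃ a ∈ I, ∃ b, z S = dK k w S + a + X v * b := by
    intro S
    obtain ⟨a, ha, y, hy, h⟩ := Submodule.mem_sup.1 (hw S)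
    obtain ⟨b, rfl⟩ := Ideal.mem_span_singleton'.1 hy
    exact ⟨a, ha, b, by linear_combination -h⟩
  choose a ha b hab using hab
  set w' : Finset V → MvPolynomial V k := fun S => hcs 0 q (w S) with hw'
  set b' : Finset V → MvPolynomial V k := fun S => hcs 0 q (b S) with hb'
  set a' : Finset V → MvPolynomial V k := fun S => hcs 0 (q + 1) (a S) with ha'
  have ha'I : ∀ S, a' S ∈ I := by
    intro S
    simp only [ha', hcs_zero_left]
    exact hI _ (ha S) _
  have key : z = dK k w' + a' + (X v : MvPolynomial V k) • b' := by
    funext S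
    have := congrArg (hcs 0 (q + 1)) (hab S)
    rw [hcs_self (by simpa using hz S) (by omega), map_add, map_add, dK_hcs, hcs_X_mul] at this
    simpa using this
  have hdb : ∀ S, dK k b' S ∈ I' := by
    intro S
    rw [← hcol]
    have h := hdz S
    rw [key] at h
    simp only [map_add, map_smul, dK_dK, zero_add, Pi.add_apply, Pi.smul_apply, smul_eq_mul] at h
    exact (Ideal.add_mem_iff_right _ (dK_mem I a' ha'I S)).1 h
  obtain ⟨w2, hw2⟩ := h2 q (by omega) b' (fun S => by simpa using hcs_hom 0 q (b S)) hdb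
  refine ⟨w' + (X v : MvPolynomial V k) • w2, fun S => ?_⟩
  have h3 := (hcol _).2 (hw2 S)
  have : z S - dK k (w' + (X v : MvPolynomial V k) • w2) S =
      a' S + X v * (b' S - dK k w2 S) := by
    conv_lhs => rw [key]
    simp only [map_add, map_smul, Pi.add_apply, Pi.smul_apply, smul_eq_mul]
    ring
  rw [this]
  exact I.add_mem (ha'I S) h3

lemma PP_nzd {I : Ideal (MvPolynomial V k)} (v : V) (N : ℕ)
    (hcol : ∀ f, X v * f ∈ I → f ∈ I)
    (h1 : PP (I ⊔ Ideal.span {X v}) N) : PP I N := by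
  intro p hp z hz hdz
  obtain ⟨w, hw⟩ := h1 p hp z hz (fun S => Ideal.mem_sup_left (hdz S))
  have hab : ∀ S, ∃ a ∈ I, ∃ b, z S = dK k w S + a + X v * b := by
    intro S
    obtain ⟨a, ha, y, hy, h⟩ := Submodule.mem_sup.1 (hw S)
    obtain ⟨b, rfl⟩ := Ideal.mem_span_singleton'.1 hy
    exact ⟨a, ha, b, by linear_combination -h⟩
  choose a ha b hab using hab
  have key : z = dK k w + a + (X v : MvPolynomial V k) • b := by
    funext S; simpa using hab S
  have hdb : ∀ S, dK k b S ∈ I := by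
    intro S
    apply hcol
    have h := hdz S
    rw [key] at h
    simp only [map_add, map_smul, dK_dK, zero_add, Pi.add_apply, Pi.smul_apply, smul_eq_mul] at h
    exact (Ideal.add_mem_iff_right _ (dK_mem I a ha S)).1 h
  refine ⟨w + ep (MvPolynomial V k) v b, fun S => ?_⟩
  have : z S - dK k (w + ep (MvPolynomial V k) v b) S =
      a S + ep (MvPolynomial V k) v (dK k b) S := by
    conv_lhs => rw [key]
    rw [map_add, dK_ep]
    simp only [Pi.add_apply, Pi.sub_apply, Pi.smul_apply, smul_eq_mul]
    ring
  rw [this]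
  exact I.add_mem (ha S) (ep_mem I v _ hdb S)

lemma PP_mono {I : Ideal (MvPolynomial V k)} {N N' : ℕ} (h : N ≤ N') (hP : PP I N) : PP I N' :=
  fun p hp => hP p (by omega)

lemma PP_top (N : ℕ) : PP (⊤ : Ideal (MvPolynomial V k)) N :=
  fun _ _ _ _ _ => ⟨0, fun _ => trivial⟩

end PPsec

section MIsec

variable {V : Type} [Fintype V] [DecidableEq V] {k : Type} [Field k]

/-- exponent vector of a squarefree monomial -/
noncomputable def ind (A : Finset V) : V →₀ ℕ := Finsupp.indicator A fun _ _ => 1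

lemma ind_apply (A : Finset V) (v : V) : ind A v = if v ∈ A then 1 else 0 := by
  simp [ind, Finsupp.indicator_apply]

lemma ind_le (A : Finset V) (m : V →₀ ℕ) : ind A ≤ m ↔ ∀ v ∈ A, m v ≠ 0 := by
  rw [Finsupp.le_def]
  constructor
  · intro h v hv
    have := h v
    rw [ind_apply, if_pos hv] at this; omega
  · intro h v
    rw [ind_apply]; split_ifs with hv
    · have := h v hv; omega
    · omega

variable (k) in
/-- squarefree monomial ideal of a family of finite sets -/
noncomputable def MI (F : Set (Finset V)) : Ideal (MvPolynomial V k) :=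
  Ideal.span ((fun s => monomial s (1 : k)) '' (ind '' F))

lemma mem_MI (F : Set (Finset V)) (f : MvPolynomial V k) :
    f ∈ MI k F ↔ ∀ m ∈ f.support, ∃ A ∈ F, ∀ v ∈ A, m v ≠ 0 := by
  unfold MI
  rw [mem_ideal_span_monomial_image]
  simp only [Set.exists_mem_image, ind_le]

lemma MI_hom (F : Set (Finset V)) : HomI (MI k F) := by
  intro f hf n
  rw [mem_MI] at hf ⊢
  intro m hm
  apply hf
  rw [mem_support_iff, coeff_homogeneousComponent] at hm
  rw [mem_support_iff]
  intro h; apply hm; rw [h]; simp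

lemma MI_colon (F : Set (Finset V)) (v : V) (f : MvPolynomial V k) :
    X v * f ∈ MI k F ↔ f ∈ MI k ((fun A => A.erase v) '' F) := by
  rw [mem_MI, mem_MI]
  simp only [mul_comm (X v) f, support_mul_X, Finset.mem_map, addRightEmbedding_apply,
    forall_exists_index, and_imp, forall_apply_eq_imp_iff₂, Set.exists_mem_image]
  refine forall₂_congr fun m _ => exists_congr fun A => and_congr_right fun _ => ?_
  constructor
  · intro h u hu
    have := h u (Finset.mem_of_mem_erase hu)
    simpa [Finsupp.single_apply, (Finset.ne_of_mem_erase hu).symm] using this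
  · intro h u hu
    by_cases huv : u = v
    · subst huv; simp
    · have := h u (Finset.mem_erase.2 ⟨huv, hu⟩)
      simp [this]

lemma MI_mono_of {F G : Set (Finset V)} (h : ∀ A ∈ F, ∃ B ∈ G, B ⊆ A) : MI k F ≤ MI k G := by
  intro f hf
  rw [mem_MI] at hf ⊢
  intro m hm
  obtain ⟨A, hA, hAm⟩ := hf m hm
  obtain ⟨B, hB, hBA⟩ := h A hA
  exact ⟨B, hB, fun v hv => hAm v (hBA hv)⟩

lemma MI_sup (F : Set (Finset V)) (v : V) :
    MI k F ⊔ Ideal.span {X v} = MI k (F ∪ {{v}}) := by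
  unfold MI
  rw [Set.image_union, Set.image_union, Ideal.span_union]
  congr 2
  simp only [Set.image_singleton]
  congr 1
  have : ind {v} = Finsupp.single v 1 := by
    ext u; rw [ind_apply, Finsupp.single_apply]; simp [eq_comm]
  rw [this]; rfl

lemma MI_empty_mem {F : Set (Finset V)} (h : ∅ ∈ F) : MI k F = ⊤ := by
  rw [Ideal.eq_top_iff_one, mem_MI]
  intro m _
  exact ⟨∅, h, by simp⟩

lemma PP_vars (D : Set V) : PP (MI k ((fun v => ({v} : Finset V)) '' D)) 0 := by
  suffices H : ∀ (E : Finset V) (D : Set V), (∀ v, v ∈ D ∨ v ∈ E) →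
      PP (MI k ((fun v => ({v} : Finset V)) '' D)) 0 from H Finset.univ D (by simp)
  intro E
  induction E using Finset.induction_on with
  | empty =>
    intro D hD p hp z hz _
    refine ⟨0, fun S => ?_⟩
    rw [map_zero, Pi.zero_apply, sub_zero, mem_MI]
    intro m hm
    have hdeg := (hz S).degree_eq_sum_deg_support hm
    have : ∃ v, m v ≠ 0 := by
      by_contra! hcon
      have : m = 0 := by ext v; simpa using hcon v
      subst this; simp at hdeg; omega
    obtain ⟨v, hv⟩ := this
    refine ⟨{v}, ⟨v, by simpa using hD v, rfl⟩, by simpa using hv⟩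
  | insert v E hv ih =>
    intro D hD
    by_cases hvD : v ∈ D
    · apply ih
      intro u
      rcases hD u with h | h
      · exact Or.inl h
      · rcases Finset.mem_insert.1 h with rfl | h
        · exact Or.inl hvD
        · exact Or.inr h
    · apply PP_nzd v
      · intro f hf
        rw [MI_colon] at hf
        refine MI_mono_of ?_ hf
        rintro _ ⟨_, ⟨u, hu, rfl⟩, rfl⟩
        refine ⟨{u}, ⟨u, hu, rfl⟩, ?_⟩
        have : v ≠ u := by rintro rfl; exact hvD hu
        simp [Finset.erase_eq_of_notMem, this]
      · rw [MI_sup]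
        have := ih (insert v D) (by
          intro u
          rcases hD u with h | h
          · exact Or.inl (Set.mem_insert_of_mem _ h)
          · rcases Finset.mem_insert.1 h with rfl | h
            · exact Or.inl (Set.mem_insert _ _)
            · exact Or.inr h)
        rwa [Set.image_insert_eq, Set.insert_eq, Set.union_comm] at this

/-- Exactness of the Koszul complex of `R`, homogeneous version. -/
lemma koszul_exact (e : ℕ) (z : Finset V → MvPolynomial V k)
    (hz : ∀ S, (z S).IsHomogeneous e) (h0 : constantCoeff (z ∅) = 0) (hd : dK k z = 0) :
    ∃ w : Finset V → MvPolynomial V k, dK k w = z := by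
  rcases Nat.eq_zero_or_pos e with rfl | he
  · refine ⟨0, ?_⟩
    rw [map_zero]
    have hC : ∀ S, z S = C (constantCoeff (z S)) := by
      intro S
      have := homogeneousComponent_eq_self (hz S)
      rw [homogeneousComponent_zero] at this
      rw [constantCoeff_eq]; exact this.symm
    funext S
    rw [Pi.zero_apply, hC S]
    rcases S.eq_empty_or_nonempty with rfl | ⟨v, hv⟩
    · rw [h0]; simp
    · have h := congrArg (coeff (Finsupp.single v 1)) (congrFun hd (S.erase v))
      rw [dK_apply] at h
      simp only [pd_apply, coeff_sum, Pi.zero_apply, coeff_zero, smul_eq_mul] at h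
      rw [Finset.sum_eq_single v] at h
      · rw [if_neg (by simp), Finset.insert_erase hv, hC S, mul_smul_comm, mul_comm, coeff_smul,
          coeff_C_mul, coeff_X, if_pos rfl, mul_one] at h
        have h2 := congrArg (fun y => sg v (S.erase v) • y) h
        simp only [smul_smul, sg_mul_self, one_smul, smul_zero] at h2
        rw [h2]; simp
      · intro u _ huv
        split_ifs
        · simp
        · rw [hC, mul_smul_comm, mul_comm, coeff_smul, coeff_C_mul, coeff_X, if_neg]
          · simp
          · intro h
            exact huv (Finsupp.single_left_injective one_ne_zero h)
      · simp
  · have := PP_vars (k := k) (∅ : Set V) e he z hz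
    rw [Set.image_empty] at this
    have hbot : MI k (∅ : Set (Finset V)) = ⊥ := by simp [MI]
    rw [hbot] at this
    obtain ⟨w, hw⟩ := this (by intro S; rw [hd]; simp)
    refine ⟨w, ?_⟩
    funext S
    have := hw S
    rw [Ideal.mem_bot, sub_eq_zero] at this
    exact this.symm

end MIsec


section Cmp

variable {V : Type} [Fintype V] [DecidableEq V] {k : Type} [Field k]

/-- projection to exterior degree `p` and internal degree `e` -/
noncomputable def prj {b : ℕ} (deg : Fin b → ℕ) (p e : ℕ)
    (z : Finset V → Fin b → MvPolynomial V k) : Finset V → Fin b → MvPolynomial V k :=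
  fun S l => if S.card = p then hcs (deg l) e (z S l) else 0

lemma prj_idem {b : ℕ} (deg : Fin b → ℕ) (p e : ℕ)
    (z : Finset V → Fin b → MvPolynomial V k) :
    prj deg p e (prj deg p e z) = prj deg p e z := by
  funext S l
  unfold prj
  split_ifs
  · exact hcs_hcs _ _ _
  · rfl

lemma prj_sub {b : ℕ} (deg : Fin b → ℕ) (p e : ℕ)
    (z w : Finset V → Fin b → MvPolynomial V k) :
    prj deg p e (z - w) = prj deg p e z - prj deg p e w := by
  funext S l
  simp only [prj, Pi.sub_apply, map_sub]
  split_ifs <;> simp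

lemma dK_comp {b : ℕ} (z : Finset V → Fin b → MvPolynomial V k) (S : Finset V) (l : Fin b) :
    dK k z S l = dK k (fun S => z S l) S := by
  have := dK_map (k := k) (LinearMap.proj (R := MvPolynomial V k)
    (φ := fun _ : Fin b => MvPolynomial V k) l) z
  exact (congrFun this S).symm

lemma dK_prj {b : ℕ} (deg : Fin b → ℕ) (p e : ℕ)
    (z : Finset V → Fin b → MvPolynomial V k) :
    prj deg p (e + 1) (dK k z) = dK k (prj deg (p + 1) e z) := by
  funext S l
  rw [dK_comp]
  unfold prj
  rw [dK_comp, dK_hcs, dK_apply, dK_apply]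
  split_ifs with h
  · refine Finset.sum_congr rfl fun v _ => ?_
    simp only [pd_apply]
    split_ifs with h1 h2
    · rfl
    · rfl
    · rw [Finset.card_insert_of_notMem h1] at h2; omega
  · symm
    refine Finset.sum_eq_zero fun v _ => ?_
    simp only [pd_apply]
    split_ifs with h1 h2
    · simp
    · rw [Finset.card_insert_of_notMem h1] at h2; omega
    · simp

lemma lin_apply {b b' : ℕ} (d : (Fin b' → MvPolynomial V k) →ₗ[MvPolynomial V k]
    (Fin b → MvPolynomial V k)) (f : Fin b' → MvPolynomial V k) (l : Fin b) :
    d f l = ∑ j, d (Pi.single j 1) l * f j := by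
  conv_lhs => rw [← Finset.univ_sum_single f, map_sum, Finset.sum_apply]
  refine Finset.sum_congr rfl fun j _ => ?_
  have : (Pi.single j (f j) : Fin b' → MvPolynomial V k) = f j • Pi.single j 1 := by
    rw [← Pi.single_smul]; simp
  rw [this, map_smul, Pi.smul_apply, smul_eq_mul, mul_comm]

lemma lin_hcs {b b' : ℕ} (deg : Fin b → ℕ) (deg' : Fin b' → ℕ)
    (d : (Fin b' → MvPolynomial V k) →ₗ[MvPolynomial V k] (Fin b → MvPolynomial V k))
    (hd : ∀ j l, (d (Pi.single j 1) l).IsHomogeneous (deg' j - deg l) ∧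
        (deg' j < deg l → d (Pi.single j 1) l = 0)) (e : ℕ)
    (f : Fin b' → MvPolynomial V k) (l : Fin b) :
    hcs (deg l) e (d f l) = d (fun j => hcs (deg' j) e (f j)) l := by
  rw [lin_apply, lin_apply, map_sum]
  refine Finset.sum_congr rfl fun j _ => ?_
  exact hcs_mul (hd j l).1 (hd j l).2 _

lemma prj_lin {b b' : ℕ} (deg : Fin b → ℕ) (deg' : Fin b' → ℕ)
    (d : (Fin b' → MvPolynomial V k) →ₗ[MvPolynomial V k] (Fin b → MvPolynomial V k))
    (hd : ∀ j l, (d (Pi.single j 1) l).IsHomogeneous (deg' j - deg l) ∧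
        (deg' j < deg l → d (Pi.single j 1) l = 0)) (p e : ℕ)
    (z : Finset V → Fin b' → MvPolynomial V k) :
    prj deg p e (fun S => d (z S)) = fun S => d (prj deg' p e z S) := by
  funext S l
  unfold prj
  split_ifs with h
  · exact lin_hcs deg deg' d hd e (z S) l
  · have : (fun _ : Fin b' => (0 : MvPolynomial V k)) = 0 := rfl
    rw [this, map_zero]; rfl

lemma koszul_exact_free {b : ℕ} (deg : Fin b → ℕ) (p e : ℕ)
    (z : Finset V → Fin b → MvPolynomial V k) (hz : prj deg p e z = z)
    (h0 : ∀ l, constantCoeff (z ∅ l) = 0) (hd : dK k z = 0) :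
    ∃ w : Finset V → Fin b → MvPolynomial V k, dK k w = z := by
  have : ∀ l, ∃ w : Finset V → MvPolynomial V k, dK k w = fun S => z S l := by
    intro l
    apply koszul_exact (e - deg l)
    · intro S
      rw [← hz]; unfold prj
      split_ifs
      · exact hcs_hom _ _ _
      · exact isHomogeneous_zero _ _ _
    · exact h0 l
    · funext S
      rw [← dK_comp, hd]; rfl
  choose w hw using this
  refine ⟨fun S l => w l S, ?_⟩
  funext S l
  rw [dK_comp]
  exact congrFun (hw l) S

variable {I : Ideal (MvPolynomial V k)}

/-- vanishing of Koszul homology of the cokernel of `d i` -/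
def QQ (F : MinFreeRes k V I) (i p e : ℕ) : Prop :=
  ∀ z : Finset V → Fin (F.b i) → MvPolynomial V k, prj (F.deg i) p e z = z →
    (∀ S, dK k z S ∈ Set.range (F.d i)) →
    ∃ w : Finset V → Fin (F.b i) → MvPolynomial V k, ∀ S, z S - dK k w S ∈ Set.range (F.d i)

lemma QQ_down (F : MinFreeRes k V I) (i p e : ℕ) (h : QQ F (i + 1) p (e + 1)) :
    QQ F i (p + 1) e := by
  intro z hz hdz
  choose u0 hu0 using hdz
  set u := prj (F.deg (i + 1)) p (e + 1) u0 with hu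
  have hdu : (fun S => F.d i (u S)) = dK k z := by
    rw [hu, ← prj_lin _ _ _ (F.d_homog i)]
    have : (fun S => F.d i (u0 S)) = dK k z := funext hu0
    rw [this, dK_prj, hz]
  obtain ⟨w', hw'⟩ := h u (prj_idem _ _ _ _) (by
    intro S
    rw [← F.exact_succ i]
    have := congrFun (dK_map (k := k) (F.d i) u) S
    rw [← this, hdu, dK_dK]; rfl)
  have h1 : (fun S => F.d i (dK k w' S)) = dK k z := by
    rw [← hdu]
    funext S
    have := (F.exact_succ i _).2 (hw' S)
    rw [map_sub, sub_eq_zero] at this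
    exact this.symm
  set w2 := prj (F.deg (i + 1)) (p + 1) e w' with hw2
  have h2 : dK k (fun S => F.d i (w2 S)) = dK k z := by
    rw [dK_map, hw2, ← dK_prj, ← prj_lin _ _ _ (F.d_homog i), h1, dK_prj, hz]
  obtain ⟨w, hw⟩ := koszul_exact_free (F.deg i) (p + 1) e (z - fun S => F.d i (w2 S))
    (by rw [prj_sub, hz, prj_lin _ _ _ (F.d_homog i), hw2, prj_idem])
    (by
      intro l
      have e1 : z ∅ = 0 := by rw [← hz]; funext l; simp [prj]
      have e2 : w2 ∅ = 0 := by funext l; simp [hw2, prj]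
      simp [e1, e2])
    (by rw [map_sub, h2, sub_self])
  refine ⟨w, fun S => ⟨w2 S, ?_⟩⟩
  rw [hw]; simp

lemma const_d (F : MinFreeRes k V I) (i : ℕ) (f : Fin (F.b (i + 1)) → MvPolynomial V k)
    (l : Fin (F.b i)) : constantCoeff (F.d i f l) = 0 := by
  rw [lin_apply, map_sum]
  refine Finset.sum_eq_zero fun j _ => ?_
  rw [map_mul, F.minimal, zero_mul]

lemma QQ_up (F : MinFreeRes k V I) (i p e : ℕ) (h : QQ F i (p + 1) e) :
    QQ F (i + 1) p (e + 1) := by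
  intro u hu hdu
  set y : Finset V → Fin (F.b i) → MvPolynomial V k := fun S => F.d i (u S) with hy
  have hdy : dK k y = 0 := by
    rw [hy, dK_map]
    funext S
    exact (F.exact_succ i _).2 (hdu S)
  have hpy : prj (F.deg i) p (e + 1) y = y := by
    rw [hy, prj_lin _ _ _ (F.d_homog i), hu]
  obtain ⟨z0, hz0⟩ := koszul_exact_free (F.deg i) p (e + 1) y hpy
    (fun l => const_d F i _ l) hdy
  set z := prj (F.deg i) (p + 1) e z0 with hz
  have hdz : dK k z = y := by rw [hz, ← dK_prj, hz0, hpy]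
  obtain ⟨w, hw⟩ := h z (prj_idem _ _ _ _) (fun S => ⟨u S, by rw [hdz]⟩)
  choose v hv using hw
  refine ⟨v, fun S => ?_⟩
  rw [← F.exact_succ i, map_sub, sub_eq_zero]
  have e1 : z = dK k w + fun S => F.d i (v S) := by
    funext S; rw [Pi.add_apply, hv]; simp
  have e2 : y = fun S => F.d i (dK k v S) := by
    rw [← hdz, e1, map_add, dK_dK, zero_add, dK_map]
  exact congrFun e2 S

lemma QQ_iff (F : MinFreeRes k V I) (i e : ℕ) : QQ F 0 i e ↔ QQ F i 0 (e + i) := by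
  suffices H : ∀ j p e, QQ F j p e ↔ QQ F (j + p) 0 (e + p) by
    simpa using H 0 i e
  intro j p
  induction p generalizing j with
  | zero => intro e; simp
  | succ p ih =>
    intro e
    have h1 : QQ F j (p + 1) e ↔ QQ F (j + 1) p (e + 1) := ⟨QQ_up F j p e, QQ_down F j p e⟩
    rw [h1, ih, show j + 1 + p = j + (p + 1) by ring, show e + 1 + p = e + (p + 1) by ring]

/-- a graded lift of the augmentation -/
lemma exists_aug_lift (F : MinFreeRes k V I) :
    ∃ a : (Fin (F.b 0) → MvPolynomial V k) →ₗ[MvPolynomial V k] MvPolynomial V k,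
      (∀ f, F.aug f = Ideal.Quotient.mk I (a f)) ∧
      ∀ e f, hcs 0 e (a f) = a (fun j => hcs (F.deg 0 j) e (f j)) := by
  choose p hp1 hp2 using F.aug_homog
  refine ⟨∑ j, p j • LinearMap.proj (R := MvPolynomial V k)
    (φ := fun _ : Fin (F.b 0) => MvPolynomial V k) j, ?_, ?_⟩
  · intro f
    conv_lhs => rw [← Finset.univ_sum_single f, map_sum]
    simp only [LinearMap.sum_apply, LinearMap.smul_apply, LinearMap.proj_apply, smul_eq_mul,
      map_sum]
    refine Finset.sum_congr rfl fun j _ => ?_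
    have : (Pi.single j (f j) : Fin (F.b 0) → MvPolynomial V k) = f j • Pi.single j 1 := by
      rw [← Pi.single_smul]; simp
    rw [this, map_smul, hp2, map_mul, mul_comm]
    rfl
  · intro e f
    simp only [LinearMap.sum_apply, LinearMap.smul_apply, LinearMap.proj_apply, smul_eq_mul,
      map_sum]
    refine Finset.sum_congr rfl fun j _ => ?_
    exact hcs_mul (by simpa using hp1 j) (by omega) _

lemma range_d0 (F : MinFreeRes k V I)
    (a : (Fin (F.b 0) → MvPolynomial V k) →ₗ[MvPolynomial V k] MvPolynomial V k)
    (ha : ∀ f, F.aug f = Ideal.Quotient.mk I (a f)) (f : Fin (F.b 0) → MvPolynomial V k) :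
    f ∈ Set.range (F.d 0) ↔ a f ∈ I := by
  rw [← F.exact_zero, ha, Ideal.Quotient.eq_zero_iff_mem]

/-- Upper bound for the degrees. -/
theorem upper_bound {N : ℕ} (hP : PP I N) (F : MinFreeRes k V I) (i : ℕ) (j : Fin (F.b i)) :
    F.deg i j ≤ N + i := by
  by_contra! hlt
  obtain ⟨a, ha1, ha2⟩ := exists_aug_lift F
  have hQ0 : QQ F 0 i (F.deg i j - i) := by
    intro z hz hdz
    obtain ⟨w', hw'⟩ := hP (F.deg i j - i) (by omega) (fun S => a (z S)) (by
        intro S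
        have : hcs 0 (F.deg i j - i) (a (z S)) = a (z S) := by
          rw [ha2]
          have h : ∀ l, hcs (F.deg 0 l) (F.deg i j - i) (z S l) = z S l := by
            intro l
            have := congrFun (congrFun hz S) l
            unfold prj at this
            split_ifs at this
            · exact this
            · rw [← this]; simp
          simp only [h]
        rw [← this]
        simpa using hcs_hom 0 (F.deg i j - i) (a (z S)))
      (by
        intro S
        rw [dK_map]
        exact (range_d0 F a ha1 _).1 (hdz S))
    have : ∀ S, ∃ f, F.aug f = Ideal.Quotient.mk I (w' S) := fun S => F.aug_surjective _
    choose w hw using this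
    refine ⟨w, fun S => ?_⟩
    rw [range_d0 F a ha1, map_sub]
    have h1 : dK k (fun S => a (w S) - w' S) S ∈ I := by
      apply dK_mem
      intro S
      have := hw S
      rw [ha1, Ideal.Quotient.eq] at this
      exact this
    have h2 : dK k (fun S => a (w S) - w' S) S = a (dK k w S) - dK k w' S := by
      have : (fun S => a (w S) - w' S) = (fun S => a (w S)) - w' := rfl
      rw [this, map_sub, dK_map]; rfl
    rw [h2] at h1
    have h3 := I.sub_mem (hw' S) h1
    convert h3 using 1
    ring
  have hQ := (QQ_iff F i _).1 hQ0
  rw [show F.deg i j - i + i = F.deg i j by omega] at hQ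
  obtain ⟨w, hw⟩ := hQ (fun S => if S = ∅ then Pi.single j 1 else 0) (by
      funext S l
      unfold prj
      by_cases hS : S = ∅
      · subst hS
        simp only [Finset.card_empty, if_true]
        by_cases hl : l = j
        · subst hl
          apply hcs_self
          · simpa using isHomogeneous_one _ _
          · omega
        · rw [Pi.single_eq_of_ne hl]; simp
      · simp [hS])
    (by
      intro S
      refine ⟨0, ?_⟩
      rw [map_zero, dK_apply]
      symm
      refine Finset.sum_eq_zero fun v _ => ?_
      simp [pd_apply])
  obtain ⟨f, hf⟩ := hw ∅
  have h1 := congrArg (fun g => constantCoeff (g j)) hf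
  simp only [const_d, if_true, Pi.sub_apply, Pi.single_eq_same, map_sub, map_one] at h1
  rw [dK_apply, Finset.sum_apply, map_sum, Finset.sum_eq_zero] at h1
  · simp at h1
  · intro v _
    simp

/-- Lower bound for the degrees. -/
theorem lower_bound (hI : HomI I) (L N : ℕ) (z : Finset V → MvPolynomial V k)
    (hz : ∀ S, (z S).IsHomogeneous N) (hzL : ∀ S, S.card ≠ L → z S = 0)
    (hdz : ∀ S, dK k z S ∈ I)
    (hnb : ¬ ∃ w : Finset V → MvPolynomial V k, ∀ S, z S - dK k w S ∈ I)
    (F : MinFreeRes k V I) : ∃ j : Fin (F.b L), F.deg L j = N + L := by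
  by_contra! hcon
  apply hnb
  obtain ⟨a, ha1, ha2⟩ := exists_aug_lift F
  have hQ : QQ F L 0 (N + L) := by
    intro z hz _
    have hne : ∀ S, S ≠ ∅ → z S = 0 := by
      intro S hS
      rw [← hz]; funext l
      simp [prj, hS]
    obtain ⟨w, hw⟩ := koszul_exact_free _ _ _ z hz (by
        intro l
        rw [← hz]
        simp only [prj, Finset.card_empty, if_true]
        rcases lt_or_gt_of_ne (hcon l) with h | h
        · have := hcs_hom (F.deg L l) (N + L) (z ∅ l)
          rw [constantCoeff_eq]
          apply this.coeff_eq_zero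
          simp; omega
        · rw [hcs_zero_of_lt h]; simp)
      (by
        funext S
        rw [dK_apply]
        refine Finset.sum_eq_zero fun v _ => ?_
        rw [pd_apply]; split_ifs
        · simp
        · rw [hne _ (by simp)]; simp)
    exact ⟨w, fun S => ⟨0, by rw [hw]; simp⟩⟩
  rw [← QQ_iff] at hQ
  have : ∀ S, ∃ f, F.aug f = Ideal.Quotient.mk I (z S) := fun S => F.aug_surjective _
  choose f hf using this
  have hza : ∀ S, a (prj (F.deg 0) L N f S) - z S ∈ I := by
    intro S
    by_cases hS : S.card = L
    · have h1 := hf S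
      rw [ha1, Ideal.Quotient.eq] at h1
      have h2 := hI _ h1 N
      rw [← hcs_zero_left, map_sub, ha2, hcs_self (by simpa using hz S) (by omega)] at h2
      have : prj (F.deg 0) L N f S = fun j => hcs (F.deg 0 j) N (f S j) := by
        funext l; simp [prj, hS]
      rw [this]; exact h2
    · have : prj (F.deg 0) L N f S = 0 := by funext l; simp [prj, hS]
      rw [this, hzL S hS]; simp
  have hda : ∀ S, a (dK k (prj (F.deg 0) L N f) S) - dK k z S ∈ I := by
    intro S
    have := dK_mem I (fun S => a (prj (F.deg 0) L N f S) - z S) hza S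
    have e : (fun S => a (prj (F.deg 0) L N f S) - z S) =
      (fun S => a (prj (F.deg 0) L N f S)) - z := rfl
    rw [e, map_sub, dK_map] at this
    exact this
  obtain ⟨w, hw⟩ := hQ (prj (F.deg 0) L N f) (prj_idem _ _ _ _) (by
    intro S
    rw [range_d0 F a ha1]
    have := I.add_mem (hda S) (hdz S)
    simpa using this)
  refine ⟨fun S => a (w S), fun S => ?_⟩
  have h1 := hw S
  rw [range_d0 F a ha1, map_sub] at h1
  rw [dK_map]
  have := I.sub_mem h1 (hza S)
  convert this using 1
  ring

end Cmp


section Exist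

variable {V : Type} [Fintype V] {k : Type} [Field k]

lemma sum_hcs (d B : ℕ) (f : MvPolynomial V k) (hB : d + f.totalDegree < B) :
    ∑ e ∈ Finset.range B, hcs d e f = f := by
  obtain ⟨m, rfl⟩ : ∃ m, B = d + m := ⟨B - d, by omega⟩
  rw [Finset.sum_range_add, Finset.sum_eq_zero, zero_add]
  · conv_rhs => rw [← sum_homogeneousComponent f]
    symm
    have h1 : ∀ x, hcs d (d + x) f = homogeneousComponent x f := by
      intro x; simp [hcs]
    simp only [h1]
    apply Finset.sum_subset
    · intro x; simp only [Finset.mem_range]; omega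
    · intro x _ hx
      apply homogeneousComponent_eq_zero
      simp only [Finset.mem_range] at hx; omega
  · intro x hx
    apply hcs_zero_of_lt
    simpa using hx

/-- homogeneous component of degree `e` in a graded free module -/
noncomputable def gr {b : ℕ} (deg : Fin b → ℕ) (e : ℕ) (f : Fin b → MvPolynomial V k) :
    Fin b → MvPolynomial V k := fun l => hcs (deg l) e (f l)

/-- homogeneous generators -/
def HGen {b : ℕ} (deg : Fin b → ℕ) (M : Submodule (MvPolynomial V k) (Fin b → MvPolynomial V k))
    (n : ℕ) : Prop :=
  ∃ (deg' : Fin n → ℕ) (g : Fin n → Fin b → MvPolynomial V k),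
    (∀ j, gr deg (deg' j) (g j) = g j) ∧ Submodule.span (MvPolynomial V k) (Set.range g) = M

lemma exists_HGen {b : ℕ} (deg : Fin b → ℕ)
    (M : Submodule (MvPolynomial V k) (Fin b → MvPolynomial V k))
    (hM : ∀ f ∈ M, ∀ e, gr deg e f ∈ M) : ∃ n, HGen deg M n := by
  have hspan : Submodule.span (MvPolynomial V k) {f | f ∈ M ∧ ∃ e, gr deg e f = f} = M := by
    apply le_antisymm
    · rw [Submodule.span_le]; intro f hf; exact hf.1
    · intro f hf
      have : f = ∑ e ∈ Finset.range (∑ l, (deg l + (f l).totalDegree) + 1), gr deg e f := by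
        funext l
        rw [Finset.sum_apply]
        symm
        apply sum_hcs
        have := Finset.single_le_sum (f := fun l => deg l + (f l).totalDegree)
          (fun _ _ => Nat.zero_le _) (Finset.mem_univ l)
        omega
      rw [this]
      refine Submodule.sum_mem _ fun e _ => Submodule.subset_span ⟨hM f hf e, e, ?_⟩
      funext l; exact hcs_hcs _ _ _
  have hfg : M.FG := IsNoetherian.noetherian M
  rw [← hspan, Submodule.fg_span_iff_fg_span_finset_subset] at hfg
  obtain ⟨s, hs, hs2⟩ := hfg
  rw [hspan] at hs2
  have hs' : ∀ x : s, ∃ e, gr deg e x.1 = x.1 := fun x => (hs x.2).2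
  choose dg hdg using hs'
  let eq := (Fintype.equivFin s).symm
  refine ⟨Fintype.card s, fun j => dg (eq j), fun j => (eq j).1, fun j => hdg _, ?_⟩
  rw [hs2]
  congr 1
  ext x
  simp only [Set.mem_range, Finset.mem_coe]
  constructor
  · rintro ⟨j, rfl⟩; exact (eq j).2
  · intro hx
    exact ⟨eq.symm ⟨x, hx⟩, by simp⟩

lemma step_exists {b : ℕ} (deg : Fin b → ℕ)
    (M : Submodule (MvPolynomial V k) (Fin b → MvPolynomial V k))
    (hM : ∀ f ∈ M, ∀ e, gr deg e f ∈ M) :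
    ∃ (b' : ℕ) (deg' : Fin b' → ℕ) (d : (Fin b' → MvPolynomial V k) →ₗ[MvPolynomial V k]
      (Fin b → MvPolynomial V k)), LinearMap.range d = M ∧
      (∀ j l, (d (Pi.single j 1) l).IsHomogeneous (deg' j - deg l) ∧
        (deg' j < deg l → d (Pi.single j 1) l = 0)) ∧
      (∀ f, d f = 0 → ∀ l, constantCoeff (f l) = 0) := by
  classical
  have hex := exists_HGen deg M hM
  obtain ⟨deg', g, hg, hspan⟩ := Nat.find_spec hex
  have hmin := fun m => Nat.find_min (m := m) hex
  generalize Nat.find hex = n at deg' g hg hspan hmin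
  have hhom : ∀ j l, (Fintype.linearCombination (MvPolynomial V k) g (Pi.single j 1) l).IsHomogeneous
        (deg' j - deg l) ∧
        (deg' j < deg l → Fintype.linearCombination (MvPolynomial V k) g (Pi.single j 1) l = 0) := by
    intro j l
    rw [Fintype.linearCombination_apply_single, one_smul]
    have : g j l = hcs (deg l) (deg' j) (g j l) := (congrFun (hg j) l).symm
    constructor
    · rw [this]; exact hcs_hom _ _ _
    · intro h; rw [this]; exact hcs_zero_of_lt h _
  refine ⟨n, deg', Fintype.linearCombination (MvPolynomial V k) g, ?_, hhom, ?_⟩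
  · rw [Fintype.range_linearCombination, hspan]
  · intro f hf j0
    by_contra hc
    have hf' : Fintype.linearCombination (MvPolynomial V k) g
        (fun j => hcs (deg' j) (deg' j0) (f j)) = 0 := by
      funext l
      rw [← lin_hcs deg deg' _ hhom, hf]; simp
    rw [Fintype.linearCombination_apply] at hf'
    obtain ⟨m, rfl⟩ : ∃ m, n = m + 1 := ⟨n - 1, by have := j0.2; omega⟩
    rw [Fin.sum_univ_succAbove _ j0] at hf'
    have h0 : hcs (deg' j0) (deg' j0) (f j0) = C (constantCoeff (f j0)) := by
      simp [hcs, homogeneousComponent_zero, constantCoeff_eq]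
    rw [h0] at hf'
    have hmem : g j0 ∈ Submodule.span (MvPolynomial V k) (Set.range (g ∘ j0.succAbove)) := by
      have : g j0 = -(C (constantCoeff (f j0))⁻¹ : MvPolynomial V k) • ∑ i : Fin m,
          hcs (deg' (j0.succAbove i)) (deg' j0) (f (j0.succAbove i)) • g (j0.succAbove i) := by
        rw [eq_neg_of_add_eq_zero_right hf', neg_smul_neg, smul_smul, ← C_mul, inv_mul_cancel₀ hc,
          C_1, one_smul]
      rw [this]
      refine Submodule.smul_mem _ _ (Submodule.sum_mem _ fun i _ => Submodule.smul_mem _ _ ?_)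
      exact Submodule.subset_span ⟨i, rfl⟩
    apply hmin m (by omega)
    refine ⟨deg' ∘ j0.succAbove, g ∘ j0.succAbove, fun j => hg _, ?_⟩
    rw [← hspan]
    apply le_antisymm
    · apply Submodule.span_mono
      rintro _ ⟨i, rfl⟩; exact ⟨_, rfl⟩
    · rw [Submodule.span_le]
      rintro _ ⟨i, rfl⟩
      rcases Fin.eq_self_or_eq_succAbove j0 i with rfl | ⟨i', rfl⟩
      · exact hmem
      · exact Submodule.subset_span ⟨i', rfl⟩

variable (k V) in
/-- stage of the construction of a minimal resolution -/
structure Stg where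
  b : ℕ
  deg : Fin b → ℕ
  M : Submodule (MvPolynomial V k) (Fin b → MvPolynomial V k)
  hom : ∀ f ∈ M, ∀ e, gr deg e f ∈ M
  min : ∀ f ∈ M, ∀ l, constantCoeff (f l) = 0

lemma Stg.exists_next (s : Stg V k) : ∃ (s' : Stg V k)
    (d : (Fin s'.b → MvPolynomial V k) →ₗ[MvPolynomial V k] (Fin s.b → MvPolynomial V k)),
    LinearMap.range d = s.M ∧ LinearMap.ker d = s'.M ∧
    (∀ j l, (d (Pi.single j 1) l).IsHomogeneous (s'.deg j - s.deg l) ∧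
        (s'.deg j < s.deg l → d (Pi.single j 1) l = 0)) := by
  classical
  obtain ⟨b', deg', d, h1, h2, h3⟩ := step_exists s.deg s.M s.hom
  refine ⟨⟨b', deg', LinearMap.ker d, ?_, ?_⟩, d, h1, rfl, h2⟩
  · intro f hf e
    rw [LinearMap.mem_ker] at hf ⊢
    funext l
    have := lin_hcs s.deg deg' d h2 e f l
    rw [hf] at this
    unfold gr
    rw [← this]; simp
  · exact h3

noncomputable def Stg.next (s : Stg V k) : Stg V k := s.exists_next.choose

noncomputable def Stg.d (s : Stg V k) :
    (Fin s.next.b → MvPolynomial V k) →ₗ[MvPolynomial V k] (Fin s.b → MvPolynomial V k) :=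
  s.exists_next.choose_spec.choose

lemma Stg.d_spec (s : Stg V k) :
    LinearMap.range s.d = s.M ∧ LinearMap.ker s.d = s.next.M ∧
    (∀ j l, (s.d (Pi.single j 1) l).IsHomogeneous (s.next.deg j - s.deg l) ∧
        (s.next.deg j < s.deg l → s.d (Pi.single j 1) l = 0)) :=
  s.exists_next.choose_spec.choose_spec

noncomputable def Stg.seq (s : Stg V k) : ℕ → Stg V k
  | 0 => s
  | n + 1 => (Stg.seq s n).next

theorem exists_minFreeRes (I : Ideal (MvPolynomial V k)) (hI : HomI I)
    (hI0 : ∀ f ∈ I, constantCoeff f = 0) : Nonempty (MinFreeRes k V I) := by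
  classical
  let pr : (Fin 1 → MvPolynomial V k) →ₗ[MvPolynomial V k] MvPolynomial V k :=
    LinearMap.proj 0
  let s0 : Stg V k :=
    { b := 1
      deg := fun _ => 0
      M := Submodule.comap pr I
      hom := by
        intro f hf e
        have : f 0 ∈ I := hf
        change hcs 0 e (f 0) ∈ I
        rw [show hcs 0 e (f 0) = homogeneousComponent e (f 0) by simp [hcs]]
        exact hI _ this e
      min := by
        intro f hf l
        have : f 0 ∈ I := hf
        rw [Subsingleton.elim l 0]
        exact hI0 _ this }
  let mkI : MvPolynomial V k →ₗ[MvPolynomial V k] (MvPolynomial V k ⧸ I) := Submodule.mkQ I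
  refine ⟨
    { b := fun i => (s0.seq i).b
      deg := fun i => (s0.seq i).deg
      d := fun i => (s0.seq i).d
      aug := mkI ∘ₗ pr
      aug_surjective := ?_
      exact_zero := ?_
      exact_succ := ?_
      aug_homog := ?_
      d_homog := fun i => (s0.seq i).d_spec.2.2
      minimal := ?_ }⟩
  · intro y
    obtain ⟨x, rfl⟩ := Submodule.mkQ_surjective I y
    exact ⟨fun _ => x, rfl⟩
  · intro f
    have h := (s0.seq 0).d_spec.1
    have : f ∈ LinearMap.range (s0.seq 0).d ↔ f ∈ (s0.seq 0).M := by rw [h]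
    have h2 : Submodule.Quotient.mk (p := I) (pr f) = 0 ↔ pr f ∈ I :=
      Submodule.Quotient.mk_eq_zero I
    exact h2.trans this.symm
  · intro i f
    have h1 : f ∈ LinearMap.range (s0.seq (i + 1)).d ↔ f ∈ (s0.seq (i + 1)).M := by
      rw [(s0.seq (i + 1)).d_spec.1]
    have h2 : f ∈ LinearMap.ker (s0.seq i).d ↔ f ∈ (s0.seq i).next.M := by
      rw [(s0.seq i).d_spec.2.1]
    exact h2.trans h1.symm
  · intro j
    refine ⟨1, isHomogeneous_one _ _, ?_⟩
    change Submodule.Quotient.mk (pr (Pi.single (M := fun _ : Fin 1 => MvPolynomial V k) j 1)) = _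
    have : j = (0 : Fin 1) := Subsingleton.elim (α := Fin 1) j 0
    rw [this]
    rfl
  · intro i j l
    apply (s0.seq i).min
    rw [← (s0.seq i).d_spec.1]
    exact ⟨_, rfl⟩

end Exist


namespace RTree
section Basics
variable {V : Type} [Fintype V] [DecidableEq V] (T : RTree V)

lemma level_spec (v : V) : T.parent^[T.level v] v = T.root := by
  unfold level; exact Nat.find_spec (T.reach v)

lemma level_eq_zero {v : V} : T.level v = 0 ↔ v = T.root := by
  constructor
  · intro h
    have := T.level_spec v
    rw [h] at this; exact this
  · rintro rfl
    unfold level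
    rw [Nat.find_eq_zero]; rfl

lemma level_parent {v : V} (h : v ≠ T.root) : T.level v = T.level (T.parent v) + 1 := by
  have h0 : T.level v ≠ 0 := fun e => h (T.level_eq_zero.1 e)
  obtain ⟨n, hn⟩ := Nat.exists_eq_succ_of_ne_zero h0
  have h1 : T.parent^[n] (T.parent v) = T.root := by
    have := T.level_spec v
    rw [hn] at this
    exact this
  have h2 : T.level (T.parent v) ≤ n := by
    unfold level; exact Nat.find_min' _ h1
  have h3 : T.level v ≤ T.level (T.parent v) + 1 := by
    have := T.level_spec (T.parent v)
    unfold level at *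
    exact Nat.find_min' _ this
  omega

lemma level_parent_of_pos {v : V} (h : T.level v ≠ 0) : T.level v = T.level (T.parent v) + 1 :=
  T.level_parent fun e => h (T.level_eq_zero.2 e)

lemma level_iter (v : V) (j : ℕ) (h : j ≤ T.level v) : T.level (T.parent^[j] v) + j = T.level v := by
  induction j generalizing v with
  | zero => rfl
  | succ j ih =>
    have h1 := T.level_parent_of_pos (v := v) (by omega)
    have := ih (T.parent v) (by omega)
    rw [Function.iterate_succ_apply]
    omega

lemma ne_root_of_level {v : V} (h : T.level v ≠ 0) : v ≠ T.root :=
  fun e => h (T.level_eq_zero.2 e)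

lemma level_le_height (v : V) : T.level v ≤ T.height :=
  Finset.le_sup (f := fun v => T.level v) (Finset.mem_univ v)

lemma exists_child (hp : T.Perfect) {v : V} (h : T.level v < T.height) :
    ∃ c, T.parent c = v ∧ T.level c = T.level v + 1 := by
  by_contra hc
  push Not at hc
  have : T.IsLeaf v := by
    intro y hy
    by_contra hne
    exact hc y hy (by rw [T.level_parent hne, hy])
  have := hp v this
  omega

lemma exists_desc (hp : T.Perfect) (v : V) (j : ℕ) (h : T.level v + j ≤ T.height) :
    ∃ g, T.parent^[j] g = v ∧ T.level g = T.level v + j := by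
  induction j with
  | zero => exact ⟨v, rfl, rfl⟩
  | succ j ih =>
    obtain ⟨g, h1, h2⟩ := ih (by omega)
    obtain ⟨c, h3, h4⟩ := T.exists_child hp (v := g) (by omega)
    refine ⟨c, ?_, by omega⟩
    rw [Function.iterate_succ_apply, h3, h1]

/-- vertex set of the path on `t` vertices ending at `v` -/
def path (t : ℕ) (v : V) : Finset V := (Finset.range t).image fun j => T.parent^[j] v

lemma mem_path {t : ℕ} {v : V} (h : t ≤ T.level v + 1) {u : V} : u ∈ T.path t v ↔
    ∃ j, j < t ∧ T.parent^[j] v = u ∧ T.level u + j = T.level v := by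
  unfold path
  simp only [Finset.mem_image, Finset.mem_range]
  constructor
  · rintro ⟨j, hj, rfl⟩
    exact ⟨j, hj, rfl, T.level_iter v j (by omega)⟩
  · rintro ⟨j, hj, rfl, _⟩
    exact ⟨j, hj, rfl⟩

/-- the set of all `t`-paths -/
def paths (t : ℕ) : Set (Finset V) := {A | ∃ v, t ≤ T.level v + 1 ∧ A = T.path t v}

lemma pathMonomial_eq (k : Type) [Field k] (t : ℕ) (v : V) (h : t ≤ T.level v + 1) :
    T.pathMonomial k t v = monomial (ind (T.path t v)) 1 := by
  unfold pathMonomial path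
  rw [← Finset.prod_image (s := Finset.range t) (g := fun j => T.parent^[j] v)
    (f := fun u => (X u : MvPolynomial V k))]
  · rw [monomial_eq, Finsupp.prod_fintype _ _ (by simp), C_1, one_mul]
    simp only [ind_apply, pow_ite, pow_one, pow_zero]
    rw [Finset.prod_ite_mem, Finset.univ_inter]
  · intro i hi j hj hij
    simp only [Finset.coe_range, Set.mem_Iio] at hi hj
    have h1 := T.level_iter v i (by omega)
    have h2 := T.level_iter v j (by omega)
    simp only at hij
    rw [hij] at h1
    omega

lemma pathIdeal_eq (k : Type) [Field k] (t : ℕ) :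
    T.pathIdeal k t = MI k (T.paths t) := by
  unfold pathIdeal MI
  congr 1
  ext m
  constructor
  · rintro ⟨v, h, rfl⟩
    exact ⟨_, ⟨_, ⟨v, h, rfl⟩, rfl⟩, (T.pathMonomial_eq k t v h).symm⟩
  · rintro ⟨_, ⟨_, ⟨v, h, rfl⟩, rfl⟩, rfl⟩
    exact ⟨v, h, (T.pathMonomial_eq k t v h).symm⟩

end Basics
end RTree


section JJ
variable {V : Type} [Fintype V] [DecidableEq V] (k : Type) [Field k]

/-- partially decided ideal: variables in `C` inverted, variables in `D` killed -/
noncomputable def JJ (F : Set (Finset V)) (C D : Finset V) : Ideal (MvPolynomial V k) :=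
  MI k ((fun A => A \ C) '' F ∪ (fun v => ({v} : Finset V)) '' (D : Set V))

variable {k} {F : Set (Finset V)} {C D : Finset V} {v : V}

lemma JJ_colon (hv : v ∉ D) (f : MvPolynomial V k) :
    X v * f ∈ JJ k F C D ↔ f ∈ JJ k F (insert v C) D := by
  unfold JJ
  rw [MI_colon, Set.image_union, Set.image_image, Set.image_image]
  have h1 : (fun A : Finset V => (A \ C).erase v) = fun A => A \ insert v C := by
    funext A; ext x; simp only [Finset.mem_erase, Finset.mem_sdiff, Finset.mem_insert]; tauto
  have h2 : (fun w : V => ({w} : Finset V).erase v) '' (D : Set V) =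
      (fun w : V => ({w} : Finset V)) '' (D : Set V) := by
    apply Set.image_congr
    intro w hw
    apply Finset.erase_eq_of_notMem
    rw [Finset.mem_singleton]
    rintro rfl
    exact hv hw
  rw [h1, h2]

lemma JJ_sup : JJ k F C D ⊔ Ideal.span {X v} = JJ k F C (insert v D) := by
  unfold JJ
  rw [MI_sup]
  congr 1
  rw [Finset.coe_insert, Set.image_insert_eq, Set.union_assoc, Set.union_singleton]

lemma JJ_hom : HomI (JJ k F C D) := MI_hom _

lemma JJ_stepColon {N : ℕ} (hv : v ∉ D) (h1 : PP (JJ k F C (insert v D)) (N + 1))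
    (h2 : PP (JJ k F (insert v C) D) N) : PP (JJ k F C D) (N + 1) :=
  PP_colon JJ_hom v N (fun f => JJ_colon hv f) (by rw [JJ_sup]; exact h1) h2

lemma JJ_stepNzd {N : ℕ} (hv : v ∉ D) (hCD : Disjoint C D)
    (hA : ∀ A ∈ F, v ∈ A → (∃ w ∈ D, w ∈ A) ∨ ∃ B ∈ F, B \ C ⊆ A \ insert v C)
    (h1 : PP (JJ k F C (insert v D)) N) : PP (JJ k F C D) N := by
  apply PP_nzd v N _ (by rw [JJ_sup]; exact h1)
  intro f
  rw [JJ_colon hv]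
  intro hf
  refine MI_mono_of ?_ hf
  rintro _ (⟨A, hAF, rfl⟩ | ⟨w, hw, rfl⟩)
  · by_cases hvA : v ∈ A
    · rcases hA A hAF hvA with ⟨w, hw, hwA⟩ | ⟨B, hB, hBA⟩
      · refine ⟨{w}, Or.inr ⟨w, hw, rfl⟩, ?_⟩
        simp only [Finset.singleton_subset_iff, Finset.mem_sdiff, Finset.mem_insert, not_or]
        exact ⟨hwA, fun e => hv (e ▸ hw), fun h => Finset.disjoint_left.1 hCD h hw⟩
      · exact ⟨_, Or.inl ⟨B, hB, rfl⟩, hBA⟩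
    · refine ⟨_, Or.inl ⟨A, hAF, rfl⟩, ?_⟩
      intro x
      simp only [Finset.mem_sdiff, Finset.mem_insert, not_or]
      rintro ⟨h1, h2⟩
      exact ⟨h1, fun e => hvA (e ▸ h1), h2⟩
  · exact ⟨{w}, Or.inr ⟨w, hw, rfl⟩, le_refl _⟩

lemma JJ_base (hCD : Disjoint C D)
    (hA : ∀ A ∈ F, (∃ w ∈ D, w ∈ A) ∨ ∃ u, A \ C = {u}) : PP (JJ k F C D) 0 := by
  have : JJ k F C D = MI k ((fun v => ({v} : Finset V)) ''
      {v | ({v} : Finset V) ∈ (fun A => A \ C) '' F ∪ (fun v => ({v} : Finset V)) '' (D : Set V)}) := by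
    apply le_antisymm
    · apply MI_mono_of
      rintro _ (⟨A, hAF, rfl⟩ | ⟨w, hw, rfl⟩)
      · rcases hA A hAF with ⟨w, hw, hwA⟩ | ⟨u, hu⟩
        · refine ⟨{w}, ⟨w, Or.inr ⟨w, hw, rfl⟩, rfl⟩, ?_⟩
          simp only [Finset.singleton_subset_iff, Finset.mem_sdiff]
          exact ⟨hwA, fun h => Finset.disjoint_left.1 hCD h hw⟩
        · exact ⟨{u}, ⟨u, Or.inl ⟨A, hAF, hu⟩, rfl⟩, by simp [hu]⟩
      · exact ⟨{w}, ⟨w, Or.inr ⟨w, hw, rfl⟩, rfl⟩, le_refl _⟩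
    · apply MI_mono_of
      rintro _ ⟨v, hv, rfl⟩
      exact ⟨_, hv, le_refl _⟩
  rw [this]
  exact PP_vars _

end JJ

namespace RTree
section Upper
variable {V : Type} [Fintype V] [DecidableEq V] (T : RTree V) {k : Type} [Field k]

lemma base_case {s t : ℕ} (hst : s + t = T.height + 1) (hs : s ≤ t) (ht : 1 ≤ t)
    {C D : Finset V} (hCD : Disjoint C D)
    (h1 : ∀ v, T.level v + 2 ≤ s → v ∈ C ∨ v ∈ D)
    (h2 : ∀ v, s ≤ T.level v → T.level v + 1 ≤ T.height → v ∈ C ∨ v ∈ D)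
    (h3 : ∀ v ∈ C, T.level v + 1 ≠ s ∧ T.level v ≠ T.height) :
    PP (JJ k (T.paths t) C D) 0 := by
  apply JJ_base hCD
  rintro _ ⟨e, he, rfl⟩
  by_cases hD : ∃ w ∈ D, w ∈ T.path t e
  · exact Or.inl hD
  right
  push Not at hD
  have hle := T.level_le_height e
  by_cases hl : T.level e = T.height
  · refine ⟨e, ?_⟩
    ext x
    rw [Finset.mem_sdiff, T.mem_path he, Finset.mem_singleton]
    constructor
    · rintro ⟨⟨j, hj, rfl, hlev⟩, hxC⟩
      rcases Nat.eq_zero_or_pos j with rfl | hj0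
      · rfl
      · exfalso
        rcases h2 (T.parent^[j] e) (by omega) (by omega) with h | h
        · exact hxC h
        · exact hD _ h ((T.mem_path he).2 ⟨j, hj, rfl, hlev⟩)
    · rintro rfl
      exact ⟨⟨0, by omega, rfl, rfl⟩, fun h => (h3 _ h).2 hl⟩
  · have hlv := T.level_iter e (T.level e + 1 - s) (by omega)
    refine ⟨T.parent^[T.level e + 1 - s] e, ?_⟩
    ext x
    rw [Finset.mem_sdiff, T.mem_path he, Finset.mem_singleton]
    constructor
    · rintro ⟨⟨j, hj, rfl, hlev⟩, hxC⟩
      by_cases hjj : j = T.level e + 1 - s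
      · rw [hjj]
      · exfalso
        have : T.parent^[j] e ∈ C ∨ T.parent^[j] e ∈ D := by
          by_cases hh : T.level (T.parent^[j] e) + 2 ≤ s
          · exact h1 _ hh
          · exact h2 _ (by omega) (by omega)
        rcases this with h | h
        · exact hxC h
        · exact hD _ h ((T.mem_path he).2 ⟨j, hj, rfl, hlev⟩)
    · rintro rfl
      exact ⟨⟨_, by omega, rfl, hlv⟩, fun h => (h3 _ h).1 (by omega)⟩

lemma stage2 (hp : T.Perfect) {s t : ℕ} (hst : s + t = T.height + 1) (hs : s ≤ t) (ht : 1 ≤ t)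
    (G : Finset V) (L : Finset V) : ∀ {C D : Finset V}, Disjoint C D →
    (∀ v ∈ L, T.level v + 2 ≤ s ∧ v ∉ C ∧ v ∉ D) →
    (∀ v, T.level v + 2 ≤ s → v ∈ L ∨ v ∈ C ∨ v ∈ D) →
    (∀ v, s ≤ T.level v → T.level v + 1 ≤ T.height → v ∈ C ∨ v ∈ D) →
    (∀ v ∈ C, T.level v + 1 ≠ s ∧ T.level v ≠ T.height) →
    (∀ v ∈ C, s < T.level v → T.parent v ∈ C) →
    (∀ g ∈ D, s ≤ T.level g → T.parent^[t] g ∈ G) →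
    PP (JJ k (T.paths t) C D) (L ∩ G).card := by
  induction L using Finset.induction_on with
  | empty =>
    intro C D hCD _ h1 h2 h3 _ _
    rw [Finset.empty_inter, Finset.card_empty]
    exact T.base_case hst hs ht hCD (fun v hv => by simpa using h1 v hv) h2 h3
  | insert v L hvL ih =>
    intro C D hCD hL h1 h2 h3 h4 h5
    obtain ⟨hlv, hvC, hvD⟩ := hL v (Finset.mem_insert_self _ _)
    have ihD : PP (JJ k (T.paths t) C (insert v D)) (L ∩ G).card := by
      apply ih
      · rw [Finset.disjoint_insert_right]; exact ⟨hvC, hCD⟩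
      · intro w hw
        obtain ⟨a, b, c⟩ := hL w (Finset.mem_insert_of_mem hw)
        refine ⟨a, b, ?_⟩
        rw [Finset.mem_insert, not_or]
        exact ⟨fun e => hvL (e ▸ hw), c⟩
      · intro w hw
        have := h1 w hw
        simp only [Finset.mem_insert] at this ⊢
        tauto
      · intro w a b
        have := h2 w a b
        simp only [Finset.mem_insert]
        tauto
      · exact h3
      · exact h4
      · intro g hg
        rcases Finset.mem_insert.1 hg with rfl | hg
        · intro; omega
        · exact h5 g hg
    by_cases hG : v ∈ G
    · rw [Finset.insert_inter_of_mem hG,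
        Finset.card_insert_of_notMem (fun h => hvL (Finset.mem_inter.1 h).1)]
      apply JJ_stepColon hvD (PP_mono (by omega) ihD)
      apply ih
      · rw [Finset.disjoint_insert_left]; exact ⟨hvD, hCD⟩
      · intro w hw
        obtain ⟨a, b, c⟩ := hL w (Finset.mem_insert_of_mem hw)
        refine ⟨a, ?_, c⟩
        rw [Finset.mem_insert, not_or]
        exact ⟨fun e => hvL (e ▸ hw), b⟩
      · intro w hw
        have := h1 w hw
        simp only [Finset.mem_insert] at this ⊢
        tauto
      · intro w a b
        have := h2 w a b
        simp only [Finset.mem_insert]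
        tauto
      · intro w hw
        rcases Finset.mem_insert.1 hw with rfl | hw
        · omega
        · exact h3 w hw
      · intro w hw
        rcases Finset.mem_insert.1 hw with rfl | hw
        · intro; omega
        · intro h; exact Finset.mem_insert_of_mem (h4 w hw h)
      · exact h5
    · rw [Finset.insert_inter_of_notMem hG]
      apply JJ_stepNzd hvD hCD _ ihD
      rintro _ ⟨e, he, rfl⟩ hve
      have hle := T.level_le_height e
      obtain ⟨jv, hjv, hjve, hjvl⟩ := (T.mem_path he).1 hve
      right
      -- the vertex of the path at level s-1
      have hul := T.level_iter e (T.level e + 1 - s) (by omega)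
      set u := T.parent^[T.level e + 1 - s] e with hu
      obtain ⟨g, hgu, hgl⟩ := T.exists_desc hp u (T.level v + t + 1 - s) (by omega)
      have hgt : T.parent^[t] g = v := by
        have : t = (jv - (T.level e + 1 - s)) + (T.level v + t + 1 - s) := by omega
        rw [this, Function.iterate_add_apply, hgu, hu, ← Function.iterate_add_apply,
          show jv - (T.level e + 1 - s) + (T.level e + 1 - s) = jv by omega, hjve]
      have hgC : g ∈ C := by
        rcases h2 g (by omega) (by omega) with h | h
        · exact h
        · exact absurd (hgt ▸ h5 g h (by omega)) hG
      have hanc : ∀ j, j < T.level v + t + 1 - s → T.parent^[j] g ∈ C := by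
        intro j
        induction j with
        | zero => intro; exact hgC
        | succ j ihj =>
          intro hj
          rw [Function.iterate_succ_apply']
          have := T.level_iter g j (by omega)
          exact h4 _ (ihj (by omega)) (by omega)
      have hgp : t ≤ T.level g + 1 := by omega
      refine ⟨T.path t g, ⟨g, hgp, rfl⟩, ?_⟩
      intro x hx
      rw [Finset.mem_sdiff, T.mem_path hgp] at hx
      obtain ⟨⟨j, hj, hjx, hjl⟩, hxC⟩ := hx
      rw [Finset.mem_sdiff, Finset.mem_insert, not_or]
      refine ⟨?_, ?_, hxC⟩
      · rw [T.mem_path he]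
        have hjge : T.level v + t + 1 - s ≤ j := by
          by_contra hlt
          exact hxC (hjx ▸ hanc j (by omega))
        refine ⟨(j - (T.level v + t + 1 - s)) + (T.level e + 1 - s), by omega, ?_, by omega⟩
        rw [Function.iterate_add_apply, ← hu, ← hgu, ← Function.iterate_add_apply, Nat.sub_add_cancel hjge, hjx]
      · rintro rfl; omega

lemma stage1 (hp : T.Perfect) {s t : ℕ} (hst : s + t = T.height + 1) (hs : s ≤ t) (ht : 1 ≤ t)
    (n : ℕ) : ∀ {L C D : Finset V}, L.card = n → Disjoint C D → Disjoint L C → Disjoint L D →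
    (∀ v, (v ∈ L ∨ v ∈ C ∨ v ∈ D) ↔ (s ≤ T.level v ∧ T.level v + 1 ≤ T.height)) →
    (∀ v ∈ C, s < T.level v → T.parent v ∈ C) →
    PP (JJ k (T.paths t) C D) (n + D.card) := by
  induction n with
  | zero =>
    intro L C D hn hCD _ _ h1 h2
    rw [Finset.card_eq_zero] at hn
    subst hn
    simp only [Finset.notMem_empty, false_or] at h1
    have := T.stage2 (k := k) hp hst hs ht (D.image T.parent^[t])
      (Finset.univ.filter fun v => T.level v + 2 ≤ s) hCD
      (fun v hv => by
        have hv := (Finset.mem_filter.1 hv).2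
        have h := h1 v
        refine ⟨hv, fun hC => ?_, fun hD => ?_⟩
        · have := h.1 (Or.inl hC); omega
        · have := h.1 (Or.inr hD); omega)
      (fun v hv => Or.inl (by simpa using hv))
      (fun v a b => (h1 v).2 ⟨a, b⟩)
      (fun v hv => by have := (h1 v).1 (Or.inl hv); omega)
      h2
      (fun g hg _ => Finset.mem_image_of_mem _ hg)
    refine PP_mono ?_ this
    rw [zero_add]
    exact (Finset.card_le_card Finset.inter_subset_right).trans Finset.card_image_le
  | succ n ih =>
    intro L C D hn hCD hLC hLD h1 h2
    obtain ⟨v, hvL, hmin⟩ := Finset.exists_min_image L T.level (by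
      rw [← Finset.card_pos]; omega)
    have hvC : v ∉ C := Finset.disjoint_left.1 hLC hvL
    have hvD : v ∉ D := Finset.disjoint_left.1 hLD hvL
    have hv := (h1 v).1 (Or.inl hvL)
    have hcard : (L.erase v).card = n := by rw [Finset.card_erase_of_mem hvL]; omega
    have ihD : PP (JJ k (T.paths t) C (insert v D)) (n + 1 + D.card) := by
      have := ih (L := L.erase v) (C := C) (D := insert v D) hcard
        (by rw [Finset.disjoint_insert_right]; exact ⟨hvC, hCD⟩)
        (hLC.mono_left (Finset.erase_subset _ _))
        (by
          rw [Finset.disjoint_insert_right]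
          exact ⟨Finset.notMem_erase _ _, hLD.mono_left (Finset.erase_subset _ _)⟩)
        (by
          intro w
          rw [← h1 w, Finset.mem_erase, Finset.mem_insert]
          by_cases hw : w = v
          · subst hw; tauto
          · tauto)
        h2
      rw [Finset.card_insert_of_notMem hvD] at this
      exact PP_mono (by omega) this
    by_cases hdead : s < T.level v ∧ T.parent v ∉ C
    · obtain ⟨hlt, hpC⟩ := hdead
      apply JJ_stepNzd hvD hCD _ ihD
      rintro _ ⟨e, he, rfl⟩ hve
      have hle := T.level_le_height e
      have hlp := T.level_parent_of_pos (v := v) (by omega)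
      left
      refine ⟨T.parent v, ?_, ?_⟩
      · have := (h1 (T.parent v)).2 ⟨by omega, by omega⟩
        rcases this with h | h | h
        · have := hmin _ h; omega
        · exact absurd h hpC
        · exact h
      · rw [T.mem_path he] at hve ⊢
        obtain ⟨j, hj, hjv, hjl⟩ := hve
        exact ⟨j + 1, by omega, by rw [Function.iterate_succ_apply', hjv], by omega⟩
    · rw [show n + 1 + D.card = (n + D.card) + 1 by omega] at ihD ⊢
      apply JJ_stepColon hvD ihD
      apply ih (L := L.erase v) hcard
      · rw [Finset.disjoint_insert_left]; exact ⟨hvD, hCD⟩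
      · rw [Finset.disjoint_insert_right]
        exact ⟨Finset.notMem_erase _ _, hLC.mono_left (Finset.erase_subset _ _)⟩
      · exact hLD.mono_left (Finset.erase_subset _ _)
      · intro w
        rw [← h1 w, Finset.mem_erase, Finset.mem_insert]
        by_cases hw : w = v
        · subst hw; tauto
        · tauto
      · intro w hw hlw
        rcases Finset.mem_insert.1 hw with rfl | hw
        · apply Finset.mem_insert_of_mem
          by_contra hc
          exact hdead ⟨hlw, hc⟩
        · exact Finset.mem_insert_of_mem (h2 w hw hlw)

/-- vertices at levels `s..h-1` -/
noncomputable def FF (s : ℕ) : Finset V :=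
  Finset.univ.filter fun v => s ≤ T.level v ∧ T.level v + 1 ≤ T.height

lemma mem_FF {s : ℕ} {v : V} : v ∈ T.FF s ↔ s ≤ T.level v ∧ T.level v + 1 ≤ T.height := by
  simp [FF]

theorem PP_pathIdeal (hp : T.Perfect) {s t : ℕ} (hst : s + t = T.height + 1) (hs : s ≤ t)
    (ht : 1 ≤ t) : PP (T.pathIdeal k t) (T.FF s).card := by
  have := T.stage1 (k := k) hp hst hs ht _ (L := T.FF s) (C := ∅) (D := ∅) rfl
    (by simp) (by simp) (by simp) (by simp [mem_FF]) (by simp)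
  rw [pathIdeal_eq]
  simpa [JJ] using this

end Upper
end RTree


section Rho
variable {V : Type} [Fintype V] [DecidableEq V] (k : Type) [Field k] (W : Finset V) (c : V → V)

/-- dual cocycle -/
noncomputable def rho : List V → (Finset V → k)
  | [] => fun S => if S = W then 1 else 0
  | v :: l => pd k v (rho l) - pd k (c v) (rho l)

/-- exterior multiplication by the sum of the vertices in `W` -/
noncomputable def theta : (Finset V → k) →ₗ[k] (Finset V → k) := ∑ u ∈ W, ep k u

variable {k W c}

lemma theta_pd {v : V} (hv : v ∈ W) (z : Finset V → k) :
    theta k W (pd k v z) = z - pd k v (theta k W z) := by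
  have : pd k v (theta k W z) + theta k W (pd k v z) = z := by
    simp only [theta, LinearMap.sum_apply, map_sum, ← Finset.sum_add_distrib, pd_ep]
    simp [hv]
  rw [eq_sub_iff_add_eq, add_comm]; exact this

lemma theta_rho (l : List V) (hl : ∀ v ∈ l, v ∈ W ∧ c v ∈ W) : theta k W (rho k W c l) = 0 := by
  induction l with
  | nil =>
    funext S
    simp only [theta, LinearMap.sum_apply, Finset.sum_apply, rho, ep_apply, Pi.zero_apply]
    refine Finset.sum_eq_zero fun u hu => ?_
    rw [if_neg (c := S.erase u = W), smul_zero, ite_self]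
    intro h
    rw [← h] at hu
    exact Finset.notMem_erase _ _ hu
  | cons v l ih =>
    have h := hl v List.mem_cons_self
    have ih := ih fun u hu => hl u (List.mem_cons_of_mem _ hu)
    rw [rho, map_sub, theta_pd h.1, theta_pd h.2, ih]
    simp

lemma rho_cons_ne {v : V} {l : List V} {S : Finset V} (h : rho k W c (v :: l) S ≠ 0) :
    (v ∉ S ∧ rho k W c l (insert v S) ≠ 0) ∨ (c v ∉ S ∧ rho k W c l (insert (c v) S) ≠ 0) := by
  by_contra hc
  push Not at hc
  apply h
  rw [rho, Pi.sub_apply, pd_apply, pd_apply]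
  have h1 : (if v ∈ S then (0 : k) else sg v S • rho k W c l (insert v S)) = 0 := by
    split_ifs with hh
    · rfl
    · rw [hc.1 hh, smul_zero]
  have h2 : (if c v ∈ S then (0 : k) else sg (c v) S • rho k W c l (insert (c v) S)) = 0 := by
    split_ifs with hh
    · rfl
    · rw [hc.2 hh, smul_zero]
  rw [h1, h2, sub_zero]

lemma rho_subset (l : List V) : ∀ {S : Finset V}, rho k W c l S ≠ 0 → S ⊆ W := by
  induction l with
  | nil =>
    intro S h
    simp only [rho, ne_eq, ite_eq_right_iff, one_ne_zero, imp_false, not_not] at h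
    exact h.le
  | cons v l ih =>
    intro S h
    rcases rho_cons_ne h with ⟨_, h⟩ | ⟨_, h⟩
    · exact (Finset.subset_insert _ _).trans (ih h)
    · exact (Finset.subset_insert _ _).trans (ih h)

lemma rho_mem (l : List V) : ∀ {S : Finset V}, rho k W c l S ≠ 0 → ∀ v ∈ W, v ∉ l →
    (∀ u ∈ l, v ≠ c u) → v ∈ S := by
  induction l with
  | nil =>
    intro S h v hv _ _
    simp only [rho, ne_eq, ite_eq_right_iff, one_ne_zero, imp_false, not_not] at h
    rw [h]; exact hv
  | cons x l ih =>
    intro S h v hv hvl hvc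
    rw [List.mem_cons, not_or] at hvl
    have hvc' := fun u hu => hvc u (List.mem_cons_of_mem x hu)
    rcases rho_cons_ne h with ⟨_, h⟩ | ⟨_, h⟩
    · exact Finset.mem_of_mem_insert_of_ne (ih h v hv hvl.2 hvc') hvl.1
    · exact Finset.mem_of_mem_insert_of_ne (ih h v hv hvl.2 hvc') (hvc x List.mem_cons_self)

lemma rho_val (lev : V → ℕ) (l : List V) (hnd : l.Nodup) (hW : ∀ v ∈ l, v ∈ W)
    (hlev : ∀ v ∈ l, lev (c v) = lev v + 1) (hs : l.Pairwise fun a b => lev a ≤ lev b) :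
    rho k W c l (W \ l.toFinset) ≠ 0 := by
  induction l with
  | nil => simp [rho]
  | cons x l ih =>
    rw [List.nodup_cons] at hnd
    rw [List.pairwise_cons] at hs
    have hxW := hW x List.mem_cons_self
    have ih := ih hnd.2 (fun u hu => hW u (List.mem_cons_of_mem _ hu))
      (fun u hu => hlev u (List.mem_cons_of_mem _ hu)) hs.2
    have hx := hlev x List.mem_cons_self
    have hxS : x ∉ W \ (x :: l).toFinset := by simp
    rw [rho, Pi.sub_apply, pd_apply, pd_apply, if_neg hxS]
    have h1 : insert x (W \ (x :: l).toFinset) = W \ l.toFinset := by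
      ext y
      simp only [Finset.mem_insert, Finset.mem_sdiff, List.mem_toFinset, List.mem_cons]
      by_cases hy : y = x
      · subst hy; simp [hxW, hnd.1]
      · simp [hy]
    have h2 : (if c x ∈ W \ (x :: l).toFinset then (0 : k) else
        sg (c x) (W \ (x :: l).toFinset) • rho k W c l (insert (c x) (W \ (x :: l).toFinset))) = 0 := by
      split_ifs with hh
      · rfl
      · by_contra hne
        have hne' : rho k W c l (insert (c x) (W \ (x :: l).toFinset)) ≠ 0 := by
          intro h0; exact hne (by rw [h0, smul_zero])
        have := rho_mem l hne' x hxW hnd.1 (by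
          intro u hu e
          have h3 := hs.1 u hu
          have h4 := hlev u (List.mem_cons_of_mem _ hu)
          rw [e] at h3
          omega)
        rcases Finset.mem_insert.1 this with e | h
        · rw [← e] at hx; omega
        · exact hxS h
    rw [h2, sub_zero, h1]
    intro h0
    have := congrArg (fun y => sg x (W \ (x :: l).toFinset) • y) h0
    simp only [smul_smul, sg_mul_self, one_smul, smul_zero] at this
    exact ih this

variable (k W) in
/-- the functional -/
noncomputable def Phi (r : Finset V → k) (z : Finset V → MvPolynomial V k) : k :=
  ∑ S ∈ W.powerset, r S * coeff (ind (W \ S)) (z S)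

lemma Phi_dK (r : Finset V → k) (hr : theta k W r = 0) (w : Finset V → MvPolynomial V k) :
    Phi k W r (dK k w) = 0 := by
  have h1 : Phi k W r (dK k w) = ∑ v ∈ W, ∑ S ∈ W.powerset.filter (fun S => v ∉ S),
      sg v S • (r S * coeff (ind (W \ insert v S)) (w (insert v S))) := by
    unfold Phi
    simp only [dK_apply, coeff_sum, Finset.mul_sum, Finset.sum_filter]
    rw [Finset.sum_comm]
    rw [← Finset.sum_subset (Finset.subset_univ W)]
    · refine Finset.sum_congr rfl fun v hv => Finset.sum_congr rfl fun S hS => ?_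
      rw [smul_eq_mul, pd_apply]
      by_cases hvS : v ∈ S
      · simp [hvS]
      · rw [if_neg hvS, if_pos hvS, coeff_X_mul', if_pos]
        · have : ind (W \ S) - Finsupp.single v 1 = ind (W \ insert v S) := by
            ext x
            simp only [Finsupp.tsub_apply, ind_apply, Finsupp.single_apply, Finset.mem_sdiff,
              Finset.mem_insert]
            by_cases hx : v = x
            · subst hx; simp [hv, hvS]
            · have : ¬ x = v := fun e => hx e.symm
              simp [hx, this]
          rw [this, coeff_smul, mul_smul_comm]
        · rw [Finsupp.mem_support_iff, ind_apply, if_pos (by simp [hv, hvS])]; simp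
    · intro v _ hv
      refine Finset.sum_eq_zero fun S _ => ?_
      rw [smul_eq_mul, coeff_X_mul', if_neg, mul_zero]
      rw [Finsupp.mem_support_iff, ind_apply, if_neg (by simp [hv])]; simp
  have h2 : ∀ v ∈ W, ∑ S ∈ W.powerset.filter (fun S => v ∉ S),
      sg v S • (r S * coeff (ind (W \ insert v S)) (w (insert v S))) =
      ∑ S ∈ W.powerset, ep k v r S * coeff (ind (W \ S)) (w S) := by
    intro v hv
    rw [← Finset.sum_filter_add_sum_filter_not W.powerset (fun S => v ∈ S)
      (fun S => ep k v r S * coeff (ind (W \ S)) (w S))]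
    rw [Finset.sum_eq_zero (s := W.powerset.filter (fun S => ¬ v ∈ S))
      (f := fun S => ep k v r S * coeff (ind (W \ S)) (w S)), add_zero]
    · refine Finset.sum_nbij' (fun S => insert v S) (fun S => S.erase v) ?_ ?_ ?_ ?_ ?_
      · intro S hS
        simp only [Finset.mem_filter, Finset.mem_powerset] at hS ⊢
        exact ⟨Finset.insert_subset hv hS.1, Finset.mem_insert_self _ _⟩
      · intro S hS
        simp only [Finset.mem_filter, Finset.mem_powerset] at hS ⊢
        exact ⟨(Finset.erase_subset _ _).trans hS.1, Finset.notMem_erase _ _⟩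
      · intro S hS
        simp only [Finset.mem_filter] at hS
        exact Finset.erase_insert hS.2
      · intro S hS
        simp only [Finset.mem_filter] at hS
        exact Finset.insert_erase hS.2
      · intro S hS
        simp only [Finset.mem_filter] at hS
        rw [ep_apply, if_pos (Finset.mem_insert_self _ _), sg_insert_self,
          Finset.erase_insert hS.2, smul_mul_assoc]
    · intro S hS
      simp only [Finset.mem_filter] at hS
      rw [ep_apply, if_neg hS.2, zero_mul]
  rw [h1, Finset.sum_congr rfl h2, Finset.sum_comm]
  refine Finset.sum_eq_zero fun S _ => ?_
  rw [← Finset.sum_mul]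
  have := congrFun hr S
  simp only [theta, LinearMap.sum_apply, Finset.sum_apply, Pi.zero_apply] at this
  rw [this, zero_mul]

end Rho

namespace RTree
section Lower
variable {V : Type} [Fintype V] [DecidableEq V] (T : RTree V) {k : Type} [Field k]

lemma rho_meets {s : ℕ} {W : Finset V} (hW : ∀ v, v ∈ W ↔ s ≤ T.level v) {c : V → V}
    (hc : ∀ v, T.level v + 1 ≤ T.height → T.parent (c v) = v ∧ T.level (c v) = T.level v + 1)
    {y : V} (hy : T.level y = T.height) (l : List V) (hnd : l.Nodup)
    (hl : ∀ v ∈ l, s ≤ T.level v ∧ T.level v + 1 ≤ T.height)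
    (hs : l.Pairwise fun a b => T.level a ≤ T.level b) :
    ∀ (m : ℕ) (S : Finset V), m + s ≤ T.height → (∀ u ∈ l, T.parent^[m] y ≠ c u) →
      rho k W c l S ≠ 0 → ∃ j ≤ m, T.parent^[j] y ∈ S := by
  induction l with
  | nil =>
    intro m S hm _ h
    simp only [rho, ne_eq, ite_eq_right_iff, one_ne_zero, imp_false, not_not] at h
    refine ⟨0, Nat.zero_le _, ?_⟩
    rw [h, hW]
    change s ≤ T.level y
    omega
  | cons x l ih =>
    intro m S hm ha h
    rw [List.nodup_cons] at hnd
    rw [List.pairwise_cons] at hs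
    have ih := ih hnd.2 (fun v hv => hl v (List.mem_cons_of_mem _ hv)) hs.2
    have ha' := fun u hu => ha u (List.mem_cons_of_mem x hu)
    have hlx := hl x List.mem_cons_self
    rcases rho_cons_ne h with ⟨hxS, h⟩ | ⟨hxS, h⟩
    · by_cases hP : ∃ i ≤ m, T.parent^[i] y = x
      · obtain ⟨i, him, hi⟩ := hP
        have hil := T.level_iter y i (by omega)
        rw [hi] at hil
        obtain ⟨i, rfl⟩ : ∃ i', i = i' + 1 := ⟨i - 1, by omega⟩
        obtain ⟨j, hj, hjS⟩ := ih i (insert x S) (by omega) (by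
          intro u hu e
          have h1 := (hc u (hl u (List.mem_cons_of_mem _ hu)).2).1
          rw [← e, ← Function.iterate_succ_apply' T.parent, hi] at h1
          exact hnd.1 (h1 ▸ hu)) h
        refine ⟨j, by omega, Finset.mem_of_mem_insert_of_ne hjS ?_⟩
        intro e
        have := T.level_iter y j (by omega)
        rw [e] at this
        omega
      · push Not at hP
        obtain ⟨j, hj, hjS⟩ := ih m _ hm ha' h
        exact ⟨j, hj, Finset.mem_of_mem_insert_of_ne hjS (hP j hj)⟩
    · by_cases hP : ∃ i ≤ m, T.parent^[i] y = c x
      · obtain ⟨i, him, hi⟩ := hP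
        have hne : i ≠ m := by
          rintro rfl
          exact ha x List.mem_cons_self hi
        refine ⟨i + 1, by omega, ?_⟩
        have hcx := hc x hlx.2
        rw [Function.iterate_succ_apply', hi, hcx.1]
        have := rho_mem l h x ((hW x).2 hlx.1) hnd.1 (by
          intro u hu e
          have h3 := hs.1 u hu
          have h4 := (hc u (hl u (List.mem_cons_of_mem _ hu)).2).2
          rw [← e] at h4
          omega)
        refine Finset.mem_of_mem_insert_of_ne this ?_
        intro e
        have := hcx.2
        rw [← e] at this
        omega
      · push Not at hP
        obtain ⟨j, hj, hjS⟩ := ih m _ hm ha' h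
        exact ⟨j, hj, Finset.mem_of_mem_insert_of_ne hjS (hP j hj)⟩

lemma exists_sorted (F : Finset V) : ∃ l : List V, l.Nodup ∧ l.toFinset = F ∧
    l.Pairwise fun a b => T.level a ≤ T.level b := by
  refine ⟨F.toList.mergeSort (fun a b => decide (T.level a ≤ T.level b)), ?_, ?_, ?_⟩
  · rw [(List.mergeSort_perm _ _).nodup_iff]; exact F.nodup_toList
  · rw [List.toFinset_eq_of_perm _ _ (List.mergeSort_perm _ _), Finset.toList_toFinset]
  · have := List.pairwise_mergeSort (le := fun a b => decide (T.level a ≤ T.level b))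
      (by intro a b c; simp only [decide_eq_true_eq]; omega)
      (by intro a b; simp only [Bool.or_eq_true, decide_eq_true_eq]; omega) F.toList
    exact this.imp (by intro a b h; simpa using h)

/-- the set of leaves -/
noncomputable def YY : Finset V := Finset.univ.filter fun v => T.level v = T.height

theorem deg_pathIdeal (hp : T.Perfect) {s t : ℕ} (hst : s + t = T.height + 1)
    (ht : 1 ≤ t) (R : MinFreeRes k V (T.pathIdeal k t)) :
    ∃ j, R.deg T.YY.card j = (T.FF s).card + T.YY.card := by
  have hcex : ∀ v, ∃ c, T.level v + 1 ≤ T.height → T.parent c = v ∧ T.level c = T.level v + 1 := by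
    intro v
    by_cases h : T.level v + 1 ≤ T.height
    · obtain ⟨c, hc⟩ := T.exists_child hp (v := v) (by omega)
      exact ⟨c, fun _ => hc⟩
    · exact ⟨v, fun h' => absurd h' h⟩
  choose c hc using hcex
  obtain ⟨l, hnd, hlF, hs⟩ := T.exists_sorted (T.FF s)
  have hl : ∀ v ∈ l, s ≤ T.level v ∧ T.level v + 1 ≤ T.height := by
    intro v hv
    rw [← T.mem_FF, ← hlF, List.mem_toFinset]; exact hv
  let W : Finset V := Finset.univ.filter fun v => s ≤ T.level v
  have hW : ∀ v, v ∈ W ↔ s ≤ T.level v := by intro v; simp [W]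
  have hY : ∀ v, v ∈ T.YY ↔ T.level v = T.height := by intro v; simp [YY]
  have hYW : W \ T.FF s = T.YY := by
    ext v
    rw [Finset.mem_sdiff, hW, hY, T.mem_FF]
    have := T.level_le_height v
    omega
  have hWY : W \ T.YY = T.FF s := by
    ext v
    rw [Finset.mem_sdiff, hW, hY, T.mem_FF]
    have := T.level_le_height v
    omega
  let z : Finset V → MvPolynomial V k := fun S => if S = T.YY then monomial (ind (T.FF s)) 1 else 0
  have hdeg : (ind (T.FF s)).degree = (T.FF s).card := by
    rw [Finsupp.degree_eq_sum]
    simp [ind_apply]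
  refine lower_bound (by rw [T.pathIdeal_eq]; exact MI_hom _) T.YY.card (T.FF s).card z ?_ ?_ ?_ ?_ R
  · intro S
    simp only [z]
    split_ifs
    · exact isHomogeneous_monomial _ hdeg
    · exact isHomogeneous_zero _ _ _
  · intro S hS
    simp only [z]
    rw [if_neg]
    rintro rfl
    exact hS rfl
  · intro S
    rw [dK_apply, T.pathIdeal_eq]
    refine Ideal.sum_mem _ fun v _ => ?_
    rw [pd_apply, smul_eq_mul]
    split_ifs with hvS
    · rw [mul_zero]; exact Ideal.zero_mem _
    · simp only [z]
      split_ifs with hSY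
      · rw [mul_smul_comm]
        apply zsmul_mem
        have hvY : T.level v = T.height := by
          rw [← hY, ← hSY]; exact Finset.mem_insert_self _ _
        rw [mem_MI]
        intro m hm
        rw [X, monomial_mul] at hm
        have hm := support_monomial_subset hm
        rw [Finset.mem_singleton] at hm
        have hvt : t ≤ T.level v + 1 := by omega
        refine ⟨T.path t v, ⟨v, hvt, rfl⟩, ?_⟩
        intro u hu
        obtain ⟨j, hj, rfl, hjl⟩ := (T.mem_path hvt).1 hu
        rw [hm, Finsupp.add_apply]
        rcases Nat.eq_zero_or_pos j with rfl | hj0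
        · simp
        · rw [ind_apply, if_pos]
          · omega
          · rw [T.mem_FF]; omega
      · rw [smul_zero, mul_zero]; exact Ideal.zero_mem _
  · rintro ⟨w, hw⟩
    rw [T.pathIdeal_eq] at hw
    have hth := theta_rho (k := k) (W := W) (c := c) l (by
      intro v hv
      have h1 := hl v hv
      have h2 := (hc v h1.2).2
      rw [hW, hW]; omega)
    have hval := rho_val (k := k) (W := W) (c := c) T.level l hnd
      (fun v hv => (hW v).2 (hl v hv).1) (fun v hv => (hc v (hl v hv).2).2) hs
    rw [hlF, hYW] at hval
    have hkill : ∀ f ∈ MI k (T.paths t), ∀ S, rho k W c l S * coeff (ind (W \ S)) f = 0 := by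
      intro f hf S
      by_contra hne
      have h1 := left_ne_zero_of_mul hne
      have h2 := right_ne_zero_of_mul hne
      rw [mem_MI] at hf
      obtain ⟨_, ⟨e, he, rfl⟩, hA⟩ := hf _ (mem_support_iff.2 h2)
      have hA' : ∀ v ∈ T.path t e, v ∈ W ∧ v ∉ S := by
        intro v hv
        have := hA v hv
        rw [ind_apply] at this
        have := (ite_ne_right_iff.1 this).1
        exact Finset.mem_sdiff.1 this
      have hle := T.level_le_height e
      have hmem : ∀ j, j < t → T.parent^[j] e ∈ T.path t e := fun j hj =>
        (T.mem_path he).2 ⟨j, hj, rfl, T.level_iter e j (by omega)⟩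
      have h3 := (hW _).1 (hA' _ (hmem (t - 1) (by omega))).1
      have h4 := T.level_iter e (t - 1) (by omega)
      obtain ⟨j, hj, hjS⟩ := T.rho_meets hW hc (y := e) (by omega) l hnd hl hs (t - 1) S (by omega)
        (by
          intro u hu e1
          have h5 := hl u hu
          have h6 := (hc u h5.2).2
          rw [← e1] at h6
          omega) h1
      exact (hA' _ (hmem j (by omega))).2 hjS
    have h1 : Phi k W (rho k W c l) z = Phi k W (rho k W c l) (dK k w) := by
      unfold Phi
      refine Finset.sum_congr rfl fun S _ => ?_
      have := hkill _ (hw S) S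
      rw [coeff_sub, mul_sub, sub_eq_zero] at this
      exact this
    rw [Phi_dK _ hth] at h1
    apply hval
    rw [← h1]
    unfold Phi
    rw [Finset.sum_eq_single T.YY]
    · simp [z, hWY]
    · intro S _ hS
      simp [z, hS]
    · intro h
      exfalso; apply h
      rw [Finset.mem_powerset, ← hYW]
      exact Finset.sdiff_subset

end Lower
end RTree


namespace RTree
section Count
variable {V : Type} [Fintype V] [DecidableEq V] (T : RTree V)

lemma outdeg_eq (x : V) :
    T.outdeg x = (Finset.univ.filter fun y => T.parent y = x ∧ y ≠ T.root).card := by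
  unfold outdeg
  rw [Nat.card_eq_fintype_card, Fintype.card_subtype]

lemma card_FF (hh : 1 ≤ T.height) {s t : ℕ} (hst : s + t = T.height + 1) :
    ((T.FF s).card : ℤ) = (if t = T.height + 1 then 1 else 0) +
        ∑ x : V, (if T.height ≤ T.level x + t ∧ T.level x + 2 ≤ T.height then
          (T.outdeg x : ℤ) else 0) := by
  have h1 : ((T.FF s).filter fun y => y ≠ T.root).card =
      ∑ x : V, (if T.height ≤ T.level x + t ∧ T.level x + 2 ≤ T.height then T.outdeg x else 0) := by
    rw [Finset.card_eq_sum_card_fiberwise (f := T.parent) (t := Finset.univ) (by simp)]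
    refine Finset.sum_congr rfl fun x _ => ?_
    split_ifs with hx
    · rw [outdeg_eq]
      congr 1
      ext y
      simp only [Finset.mem_filter, T.mem_FF, Finset.mem_univ, true_and]
      constructor
      · rintro ⟨⟨_, h⟩, h'⟩; exact ⟨h', h⟩
      · rintro ⟨rfl, h⟩
        have := T.level_parent h
        refine ⟨⟨by omega, h⟩, rfl⟩
    · rw [Finset.card_eq_zero, Finset.filter_eq_empty_iff]
      rintro y hy rfl
      simp only [Finset.mem_filter, T.mem_FF] at hy
      have := T.level_parent hy.2
      exact hx (by omega)
  have h2 : ((T.FF s).filter fun y => ¬ y ≠ T.root).card = if t = T.height + 1 then 1 else 0 := by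
    have h0 : T.level T.root = 0 := T.level_eq_zero.2 rfl
    split_ifs with ht
    · rw [Finset.card_eq_one]
      refine ⟨T.root, ?_⟩
      ext y
      simp only [Finset.mem_filter, T.mem_FF, Finset.mem_singleton, not_not]
      constructor
      · exact fun h => h.2
      · rintro rfl
        exact ⟨by omega, rfl⟩
    · rw [Finset.card_eq_zero, Finset.filter_eq_empty_iff]
      intro y hy hne
      rw [not_not] at hne
      subst hne
      rw [T.mem_FF] at hy
      omega
  rw [← Finset.card_filter_add_card_filter_not (s := T.FF s) (fun y => y ≠ T.root), h1, h2]
  push_cast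
  rw [add_comm]

end Count
end RTree

/-- Theorem B: for a perfect rooted tree of height `h ≥ 1` and
`⌈(h+1)/2⌉ ≤ t ≤ h + 1`, `reg(R/I_t(Γ)) = Σ_{h-t ≤ ℓ(x) ≤ h-2} deg⁺(x)`
(with the convention that the virtual vertex at level `-1`, occurring exactly when
`t = h + 1`, has outdegree `1`). -/
theorem reg_path_ideal_perfect
    {k V : Type} [Field k] [Fintype V] [DecidableEq V] (T : RTree V)
    (hh : 1 ≤ T.height) (hperf : T.Perfect)
    (t : ℕ) (ht1 : (T.height + 2) / 2 ≤ t) (ht2 : t ≤ T.height + 1) :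
    reg k V (T.pathIdeal k t) =
      (if t = T.height + 1 then 1 else 0) +
        ∑ x : V, (if T.height ≤ T.level x + t ∧ T.level x + 2 ≤ T.height then
          (T.outdeg x : ℤ) else 0) := by
  obtain ⟨s, hst⟩ : ∃ s, s + t = T.height + 1 := ⟨T.height + 1 - t, by omega⟩
  have hs : s ≤ t := by omega
  have ht : 1 ≤ t := by omega
  rw [← T.card_FF hh hst]
  unfold reg
  apply IsGreatest.csSup_eq
  constructor
  · have hne : Nonempty (MinFreeRes k V (T.pathIdeal k t)) := by
      apply exists_minFreeRes
      · rw [T.pathIdeal_eq]; exact MI_hom _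
      · intro f hf
        rw [T.pathIdeal_eq, mem_MI] at hf
        by_contra h0
        obtain ⟨_, ⟨v, hv, rfl⟩, hA⟩ := hf 0 (mem_support_iff.2 h0)
        exact hA v ((T.mem_path hv).2 ⟨0, by omega, rfl, rfl⟩) rfl
    obtain ⟨R⟩ := hne
    obtain ⟨j, hj⟩ := T.deg_pathIdeal hperf hst ht R
    refine ⟨R, _, j, ?_⟩
    rw [hj]; push_cast; ring
  · rintro x ⟨R, i, j, rfl⟩
    have := upper_bound (T.PP_pathIdeal (k := k) hperf hst hs ht) R i j
    omega
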